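/- arXiv:1808.04141 — 7 statements merged into one kernel-verified Lean document; each statement's English description precedes it below -/
import Mathlib

section
/- Let p be a real polynomial of degree at most d. Then there exist unique real polynomials a and b such that p = a + x·b, deg(a) ≤ d, deg(b) ≤ d−1, I_d(a) = a, and I_{d−1}(b) = b. Moreover these polynomials satisfy (1−x)·a = p − x·I_d(p) and (1−x)·b = I_d(p) − p. -/
open Polynomial
open scoped Classical

noncomputable section

/-- The complexification of a real polynomial. -/
def toC (p : ℝ[X]) : ℂ[X] := p.map (algebraMap ℝ ℂ)

/-- A complex polynomial is *stable* if it is identically zero or has no zero with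
positive imaginary part. -/
def StableC (f : ℂ[X]) : Prop := f = 0 ∨ ∀ z : ℂ, 0 < z.im → f.eval z ≠ 0

/-- `Interlaces p q` means `p ≺ q`, i.e. `q + i·p` is stable. -/
def Interlaces (p q : ℝ[X]) : Prop :=
  StableC (toC q + Polynomial.C Complex.I * toC p)

/-- A real polynomial is real-rooted if it is identically zero or all of its complex
zeros are real. -/
def RealRooted (p : ℝ[X]) : Prop :=
  p = 0 ∨ ∀ z : ℂ, (toC p).eval z = 0 → z.im = 0

/-- `Rflip d p = (-1)^d · p(-1-x)`. -/
def Rflip (d : ℕ) (p : ℝ[X]) : ℝ[X] := (-1 : ℝ) ^ d • p.comp (-1 - X)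

/-- The f-polynomial of `h` with respect to `d`:
`f(h;x) = Σ_{k=0}^d h_k x^k (1+x)^{d-k} = (1+x)^d h(x/(1+x))`. -/
def fPoly (d : ℕ) (h : ℝ[X]) : ℝ[X] :=
  ∑ k ∈ Finset.range (d + 1), Polynomial.C (h.coeff k) * X ^ k * (1 + X) ^ (d - k)

/-- The subdivision operator `E`, the unique linear map with `E(binom(x,k)) = x^k`;
here computed via Newton's forward-difference formula
`p = Σ_k (Δ^k p)(0) binom(x,k)` where `Δq = q(x+1) - q(x)`. -/
def subdivE (p : ℝ[X]) : ℝ[X] :=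
  ∑ k ∈ Finset.range (p.natDegree + 1),
    Polynomial.C (((fun q : ℝ[X] => q.comp (X + 1) - q)^[k] p).eval 0) * X ^ k

/-- `Ekd d k = E_k^d = E(x^k (x+1)^(d-k))`. -/
def Ekd (d k : ℕ) : ℝ[X] := subdivE (X ^ k * (X + 1) ^ (d - k))

/-- The cone `𝓔_d` of nonnegative combinations of the `E_k^d`, `0 ≤ k ≤ d`. -/
def coneE (d : ℕ) : Set ℝ[X] :=
  { p | ∃ c : ℕ → ℝ, (∀ i, 0 ≤ c i) ∧ p = ∑ i ∈ Finset.range (d + 1), c i • Ekd d i }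

/-- `𝓐_d = {p ∈ 𝓔_d : R_d(p) ≺ p}`. -/
def Ad (d : ℕ) : Set ℝ[X] := { p | p ∈ coneE d ∧ Interlaces (Rflip d p) p }

/-- `p` is alternatingly increasing with respect to `n`:
`0 ≤ p_0 ≤ p_n ≤ p_1 ≤ p_{n-1} ≤ ⋯ ≤ p_{⌊(n+1)/2⌋}`. -/
def AltInc (n : ℕ) (p : ℝ[X]) : Prop :=
  0 ≤ p.coeff 0 ∧ (∀ k, 2 * k ≤ n → p.coeff k ≤ p.coeff (n - k)) ∧
    (∀ k, 2 * k + 1 ≤ n → p.coeff (n - k) ≤ p.coeff (k + 1))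

/-- The number of excedances of an `r`-colored permutation `(σ, z)`:
indices `k` with `σ k > k`, or `σ k = k` and `z k > 0`. -/
def excC {n r : ℕ} (σ : Equiv.Perm (Fin n)) (z : Fin n → Fin r) : ℕ :=
  (Finset.univ.filter fun k : Fin n => k < σ k ∨ (σ k = k ∧ 0 < (z k : ℕ))).card

/-- The colored Eulerian polynomial `A_{n,r}`. -/
def coloredEulerian (n r : ℕ) : ℝ[X] :=
  ∑ σ : Equiv.Perm (Fin n), ∑ z : Fin n → Fin r, X ^ excC σ z

/-- The colored derangement polynomial `d_{n,r}`: the sum of `x^{exc(σ,z)}` over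
colored permutations with no fixed point of color `0`. -/
def coloredDerangement (n r : ℕ) : ℝ[X] :=
  ∑ σ : Equiv.Perm (Fin n),
    ∑ z ∈ Finset.univ.filter (fun z : Fin n → Fin r => ∀ k, ¬(σ k = k ∧ (z k : ℕ) = 0)),
      X ^ excC σ z

/-- The number of excedances of a permutation. -/
def excP {n : ℕ} (σ : Equiv.Perm (Fin n)) : ℕ :=
  (Finset.univ.filter fun k : Fin n => k < σ k).card

/-- The Eulerian polynomial `A_n`. -/
def eulerianPoly (n : ℕ) : ℝ[X] := ∑ σ : Equiv.Perm (Fin n), X ^ excP σ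

/-- The derangement polynomial `d_n`. -/
def derangePoly (n : ℕ) : ℝ[X] :=
  ∑ σ ∈ Finset.univ.filter (fun σ : Equiv.Perm (Fin n) => ∀ k, σ k ≠ k), X ^ excP σ

/-- The linear map `D` with `D(x^k) = d_k`. -/
def Dmap (p : ℝ[X]) : ℝ[X] :=
  ∑ k ∈ Finset.range (p.natDegree + 1), p.coeff k • derangePoly k

/-- Stability for multivariate complex polynomials: identically zero or nonvanishing
whenever all coordinates have positive imaginary part. -/
def MvStable {n : ℕ} (P : MvPolynomial (Fin n) ℂ) : Prop :=
  P = 0 ∨ ∀ z : Fin n → ℂ, (∀ j, 0 < (z j).im) → MvPolynomial.eval z P ≠ 0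

/-- The operator `T_k(f)(x) = Σ_{i=0}^k (-1)^{k-i} binom(k,i) f((i+1)x)`. -/
def Tk (k : ℕ) (f : ℝ[X]) : ℝ[X] :=
  ∑ i ∈ Finset.range (k + 1),
    ((-1 : ℝ) ^ (k - i) * (k.choose i : ℝ)) • f.comp (Polynomial.C ((i : ℝ) + 1) * X)

/-- The cone `B_{d,γ}` of nonnegative combinations of the polynomials
`x^i (x+1)^{d-i} + x^j (x+1)^{d-j}` with `i + j ≥ γ`. -/
def coneBsum (d γ : ℕ) : Set ℝ[X] :=
  { p | ∃ c : ℕ × ℕ → ℝ, (∀ ij, 0 ≤ c ij) ∧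
      p = ∑ ij ∈ (Finset.range (d + 1) ×ˢ Finset.range (d + 1)).filter
            (fun ij => γ ≤ ij.1 + ij.2),
          c ij • (X ^ ij.1 * (X + 1) ^ (d - ij.1) + X ^ ij.2 * (X + 1) ^ (d - ij.2)) }

/-- The cone `B_{d,m}` of nonnegative combinations of the polynomials
`x^j (mx+1)^{d-j}`, `0 ≤ j ≤ d`. -/
def coneBm (d m : ℕ) : Set ℝ[X] :=
  { p | ∃ c : ℕ → ℝ, (∀ j, 0 ≤ c j) ∧
      p = ∑ j ∈ Finset.range (d + 1), c j • (X ^ j * (Polynomial.C (m : ℝ) * X + 1) ^ (d - j)) }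

end
theorem aux_reflect_X_mul (d : ℕ) (b : ℝ[X]) (hb : b.degree < (d : ℕ)) :
    reflect d (X * b) = reflect (d - 1) b := by
  rcases d with _ | n
  · have : b = 0 := by
      rw [← degree_eq_bot]
      exact Nat.WithBot.lt_zero_iff.mp (by simpa using hb)
    simp [this]
  · have hn : b.natDegree ≤ n := by
      by_cases h : b = 0
      · simp [h]
      · exact Nat.lt_succ_iff.mp ((natDegree_lt_iff_degree_lt h).mpr hb)
    have h := reflect_mul (X : ℝ[X]) b (F := 1) (G := n) natDegree_X_le hn
    have hX : reflect 1 (X : ℝ[X]) = 1 := by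
      have := reflect_monomial (R := ℝ) 1 1
      rw [revAt_le (le_refl 1)] at this
      simpa using this
    rw [hX, one_mul, add_comm] at h
    simpa using h

theorem aux_reflect_reflect (d : ℕ) (p : ℝ[X]) : reflect d (reflect d p) = p := by
  ext i
  simp [coeff_reflect]

theorem aux_ne : (1 - X : ℝ[X]) ≠ 0 := by
  intro h
  have := congrArg (eval 0) h
  simp at this

theorem aux_second (d : ℕ) (p a b : ℝ[X])
    (h : p = a + X * b) (hb : b.degree < (d : ℕ))
    (ha' : reflect d a = a) (hb' : reflect (d - 1) b = b) :
    (1 - X) * a = p - X * reflect d p ∧ (1 - X) * b = reflect d p - p := by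
  have hr : reflect d p = a + b := by
    rw [h, reflect_add, ha', aux_reflect_X_mul d b hb, hb']
  rw [hr, h]
  constructor <;> ring

theorem aux_exists (d : ℕ) (p : ℝ[X]) (hp : p.degree ≤ (d : ℕ)) :
    ∃ a b : ℝ[X], p = a + X * b ∧ a.degree ≤ (d : ℕ) ∧ b.degree < (d : ℕ) ∧
      reflect d a = a ∧ reflect (d - 1) b = b := by
  have hdvd : (X - C (1 : ℝ)) ∣ p - reflect d p := by
    rw [dvd_iff_isRoot, IsRoot.def, eval_sub]
    letI : Invertible (1 : ℝ) := invertibleOne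
    have := eval₂_reflect_mul_pow (RingHom.id ℝ) 1 d p (natDegree_le_of_degree_le hp)
    simp [eval₂_id] at this
    linarith
  obtain ⟨b, hb⟩ := hdvd
  have hb1 : (1 - X) * b = reflect d p - p := by
    rw [C_1] at hb
    linear_combination hb
  have hrd : (reflect d p).degree ≤ (d : ℕ) := by
    rw [degree_le_iff_coeff_zero]
    intro m hm
    have hm' : d < m := by exact_mod_cast hm
    rw [coeff_reflect, revAt_eq_self_of_lt hm']
    exact coeff_eq_zero_of_degree_lt (lt_of_le_of_lt hp hm)
  have hbd : b.degree < (d : ℕ) := by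
    by_cases h0 : b = 0
    · simp [h0]
    · have h1 : ((X - C (1 : ℝ)) * b).degree ≤ (d : WithBot ℕ) := by
        rw [← hb]
        exact (degree_sub_le _ _).trans (max_le hp hrd)
      rw [degree_mul, degree_X_sub_C, degree_eq_natDegree h0] at h1
      rw [degree_eq_natDegree h0]
      norm_cast at h1 ⊢
      omega
  have hX := aux_reflect_X_mul d b hbd
  have hbs : reflect (d - 1) b = b := by
    have h1 : reflect d ((1 - X) * b) = p - reflect d p := by
      rw [hb1, reflect_sub, aux_reflect_reflect]
    have h2 : reflect d b = X * reflect (d - 1) b := by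
      have hd : (reflect (d - 1) b).degree < (d : ℕ) := by
        rw [degree_lt_iff_coeff_zero]
        intro m hm
        rw [coeff_reflect]
        rcases Nat.eq_zero_or_pos d with h | h
        · subst h
          have : b = 0 := by
            rw [← degree_eq_bot]
            exact Nat.WithBot.lt_zero_iff.mp (by simpa using hbd)
          simp [this]
        · rw [revAt_eq_self_of_lt (by omega)]
          exact coeff_eq_zero_of_degree_lt (lt_of_lt_of_le hbd (by exact_mod_cast hm))
      have h3 := aux_reflect_X_mul d _ hd
      rw [aux_reflect_reflect] at h3
      calc reflect d b = reflect d (reflect d (X * reflect (d - 1) b)) := by rw [h3]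
        _ = _ := aux_reflect_reflect _ _
    rw [sub_mul, one_mul, reflect_sub, hX, h2] at h1
    apply mul_left_cancel₀ aux_ne
    linear_combination -h1 - hb1
  refine ⟨p - X * b, b, by ring, ?_, hbd, ?_, hbs⟩
  · refine (degree_sub_le _ _).trans (max_le hp ?_)
    by_cases h0 : b = 0
    · simp [h0]
    · rw [degree_mul, degree_X, degree_eq_natDegree h0]
      rw [degree_eq_natDegree h0] at hbd
      norm_cast at hbd ⊢
      omega
  · rw [reflect_sub, hX, hbs]
    linear_combination -hb1

/-- symmetric `I_d`-decomposition: every real polynomial of degree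
at most `d` decomposes uniquely as `p = a + x·b` with `a, b` symmetric
(`I_d(a) = a`, `I_{d-1}(b) = b`), and moreover
`(1-x)·a = p - x·I_d(p)` and `(1-x)·b = I_d(p) - p`. -/
theorem stmt0 (d : ℕ) (p : ℝ[X]) (hp : p.degree ≤ (d : ℕ)) :
    (∃! ab : ℝ[X] × ℝ[X],
      p = ab.1 + X * ab.2 ∧ ab.1.degree ≤ (d : ℕ) ∧ ab.2.degree < (d : ℕ) ∧
        Polynomial.reflect d ab.1 = ab.1 ∧ Polynomial.reflect (d - 1) ab.2 = ab.2) ∧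
    ∀ a b : ℝ[X],
      p = a + X * b → a.degree ≤ (d : ℕ) → b.degree < (d : ℕ) →
      Polynomial.reflect d a = a → Polynomial.reflect (d - 1) b = b →
      (1 - X) * a = p - X * Polynomial.reflect d p ∧
        (1 - X) * b = Polynomial.reflect d p - p := by
  refine ⟨?_, fun a b h _ hb ha' hb' => aux_second d p a b h hb ha' hb'⟩
  obtain ⟨a, b, h, ha, hb, ha', hb'⟩ := aux_exists d p hp
  refine ⟨(a, b), ⟨h, ha, hb, ha', hb'⟩, ?_⟩
  rintro ⟨a2, b2⟩ ⟨g, _, gb, ga', gb'⟩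
  have e1 := aux_second d p a b h hb ha' hb'
  have e2 := aux_second d p a2 b2 g gb ga' gb'
  exact Prod.ext (mul_left_cancel₀ aux_ne (e2.1.trans e1.1.symm))
    (mul_left_cancel₀ aux_ne (e2.2.trans e1.2.symm))
end

section
/- Let p be a real polynomial of degree at most d. Then there exist unique real polynomials ã and b̃ such that p = ã + x·b̃, deg(ã) ≤ d, deg(b̃) ≤ d−1, R_d(ã) = ã, and R_{d−1}(b̃) = b̃. Moreover ã = (1+x)·p − x·R_d(p) and b̃ = R_d(p) − p. Additionally, f(I_d(p); x) = R_d(f(p; x)), where both f-polynomials are computed with respect to degree d. -/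
open Polynomial
open scoped Classical

lemma Rflip_invol (d : ℕ) (p : ℝ[X]) : Rflip d (Rflip d p) = p := by
  have h : ((-1 : ℝ[X]) - X).comp (-1 - X) = X := by simp
  simp only [Rflip, smul_comp, comp_assoc, h, comp_X, smul_smul, ← mul_pow]
  simp

lemma Rflip_degree_sub (d : ℕ) (p : ℝ[X]) (hp : p.degree ≤ (d : ℕ)) :
    (Rflip d p - p).degree < (d : ℕ) := by
  have hq : ((-1 : ℝ[X]) - X) = C (-1) * X + C (-1) := by simp; ring
  have hn : ((-1 : ℝ[X]) - X).natDegree = 1 := by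
    rw [hq]; exact natDegree_linear (by norm_num)
  have hl : ((-1 : ℝ[X]) - X).leadingCoeff = -1 := by
    rw [hq]; exact leadingCoeff_linear (by norm_num)
  have hpn : p.natDegree ≤ d := natDegree_le_of_degree_le hp
  have hcn : (p.comp (-1 - X)).natDegree = p.natDegree := by
    rw [natDegree_comp, hn, mul_one]
  rw [degree_lt_iff_coeff_zero]
  intro m hm
  rcases lt_or_eq_of_le (hpn.trans hm) with h | h
  · rw [coeff_sub, Rflip, coeff_smul, coeff_eq_zero_of_natDegree_lt h,
      coeff_eq_zero_of_natDegree_lt (hcn ▸ h)]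
    simp
  · have hd : d = m := by omega
    subst hd
    have h1 : (p.comp (-1 - X)).coeff d = p.coeff d * (-1) ^ d := by
      have := leadingCoeff_comp (p := p) (q := (-1 : ℝ[X]) - X) (by rw [hn]; norm_num)
      rw [hl, leadingCoeff, leadingCoeff, hcn, h] at this
      exact this
    rw [coeff_sub, Rflip, coeff_smul, h1, smul_eq_mul, mul_left_comm, ← mul_pow]
    simp

lemma Rflip_formula (d : ℕ) (p a b : ℝ[X])
    (h : p = a + X * b) (hb : b.degree < (d : ℕ))
    (ha : Rflip d a = a) (hb' : Rflip (d - 1) b = b) :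
    a = (1 + X) * p - X * Rflip d p ∧ b = Rflip d p - p := by
  have key : b = Rflip d p - p := by
    cases d with
    | zero =>
      have hb0 : b = 0 := by
        rw [← degree_eq_bot]; simpa using hb
      subst hb0
      simp only [mul_zero, add_zero] at h
      subst h
      simp [ha]
    | succ n =>
      simp only [Nat.add_sub_cancel] at hb'
      have : Rflip (n + 1) p = Rflip (n + 1) a + (1 + X) * Rflip n b := by
        rw [h]
        simp only [Rflip, add_comp, mul_comp, X_comp, smul_eq_C_mul, C_pow, C_neg, C_1]
        ring
      rw [this, ha, hb', h]; ring
  refine ⟨?_, key⟩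
  have : a = p - X * b := by rw [h]; ring
  rw [this, key]; ring

lemma fPoly_reflect (d : ℕ) (p : ℝ[X]) :
    fPoly d (Polynomial.reflect d p) = Rflip d (fPoly d p) := by
  unfold fPoly Rflip
  have hc : ∀ (s : Finset ℕ) (g : ℕ → ℝ[X]) (q : ℝ[X]),
      (∑ k ∈ s, g k).comp q = ∑ k ∈ s, (g k).comp q := fun s g q => by
    simp only [comp, eval₂_finset_sum]
  rw [← Finset.sum_range_reflect, hc, Finset.smul_sum]
  refine Finset.sum_congr rfl fun k hk => ?_
  have hk : k ≤ d := by simpa [Nat.lt_succ_iff] using hk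
  have e1 : d + 1 - 1 - k = d - k := by omega
  have e2 : d - (d - k) = k := by omega
  rw [e1, e2, coeff_reflect, revAt_le (Nat.sub_le d k), e2]
  obtain ⟨m, rfl⟩ := Nat.exists_eq_add_of_le hk
  have e3 : k + m - k = m := by omega
  rw [e3]
  have f1 : ((-1 : ℝ[X]) - X) = (-1) * (1 + X) := by ring
  have f2 : (1 : ℝ[X]) + (-1 - X) = (-1) * X := by ring
  simp only [mul_comp, C_comp, pow_comp, X_comp, add_comp, one_comp, f2,
    smul_eq_C_mul, C_pow, C_neg, C_1]
  rw [f1, mul_pow, mul_pow, pow_add]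
  have g1 : ((-1 : ℝ[X]) ^ k) * (-1) ^ k = 1 := by rw [← mul_pow]; simp
  have g2 : ((-1 : ℝ[X]) ^ m) * (-1) ^ m = 1 := by rw [← mul_pow]; simp
  linear_combination (-(C (p.coeff k) * X ^ m * (1 + X) ^ k)) * (g1 * (-1) ^ m * (-1) ^ m + g2)

/-- symmetric `R_d`-decomposition: every real polynomial of degree
at most `d` decomposes uniquely as `p = ã + x·b̃` with `R_d(ã) = ã`,
`R_{d-1}(b̃) = b̃`; moreover `ã = (1+x)·p - x·R_d(p)` and `b̃ = R_d(p) - p`.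
Additionally `f(I_d(p); x) = R_d(f(p; x))` (f-polynomials w.r.t. degree `d`). -/
theorem stmt1 (d : ℕ) (p : ℝ[X]) (hp : p.degree ≤ (d : ℕ)) :
    (∃! ab : ℝ[X] × ℝ[X],
      p = ab.1 + X * ab.2 ∧ ab.1.degree ≤ (d : ℕ) ∧ ab.2.degree < (d : ℕ) ∧
        Rflip d ab.1 = ab.1 ∧ Rflip (d - 1) ab.2 = ab.2) ∧
    (∀ a b : ℝ[X],
      p = a + X * b → a.degree ≤ (d : ℕ) → b.degree < (d : ℕ) →
      Rflip d a = a → Rflip (d - 1) b = b →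
      a = (1 + X) * p - X * Rflip d p ∧ b = Rflip d p - p) ∧
    fPoly d (Polynomial.reflect d p) = Rflip d (fPoly d p) := by
  refine ⟨⟨((1 + X) * p - X * Rflip d p, Rflip d p - p), ⟨by ring, ?_, Rflip_degree_sub d p hp, ?_, ?_⟩,
    ?_⟩, fun a b h _ hb ha hb' => Rflip_formula d p a b h hb ha hb', fPoly_reflect d p⟩
  · have hb := Rflip_degree_sub d p hp
    have e : (1 + X) * p - X * Rflip d p = p - X * (Rflip d p - p) := by ring
    show ((1 + X) * p - X * Rflip d p).degree ≤ ((d : ℕ) : WithBot ℕ)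
    rw [e]
    refine (degree_sub_le _ _).trans (max_le hp ?_)
    rw [degree_le_iff_coeff_zero]
    intro m hm
    have hm : d < m := by exact_mod_cast hm
    obtain ⟨k, rfl⟩ : ∃ k, m = k + 1 := ⟨m - 1, by omega⟩
    rw [coeff_X_mul]
    exact (degree_lt_iff_coeff_zero _ _).1 hb k (by omega)
  · have h := Rflip_invol d p
    have e : Rflip d ((1 + X) * p - X * Rflip d p)
        = -X * Rflip d p + (1 + X) * Rflip d (Rflip d p) := by
      simp only [Rflip, sub_comp, add_comp, one_comp, mul_comp, X_comp, smul_comp,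
        smul_eq_C_mul, C_pow, C_neg, C_1]
      ring
    show Rflip d ((1 + X) * p - X * Rflip d p) = _
    rw [e, h]; ring
  · show Rflip (d - 1) (Rflip d p - p) = Rflip d p - p
    cases d with
    | zero =>
      have hb := Rflip_degree_sub 0 p hp
      have hb0 : Rflip 0 p - p = 0 := by
        rw [← degree_eq_bot]; simpa using hb
      rw [hb0]; simp [Rflip]
    | succ n =>
      have h := Rflip_invol (n + 1) p
      have e : Rflip n (Rflip (n + 1) p - p)
          = -(Rflip (n + 1) (Rflip (n + 1) p)) + Rflip (n + 1) p := by
        simp only [Rflip, sub_comp, smul_comp, smul_eq_C_mul, C_pow, C_neg, C_1]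
        ring
      simp only [Nat.add_sub_cancel]
      rw [e, h]; ring
  · rintro ⟨a, b⟩ ⟨h, _, hb, ha, hb'⟩
    obtain ⟨h1, h2⟩ := Rflip_formula d p a b h hb ha hb'
    exact Prod.ext h1 h2
end

section
/- Suppose h is a real polynomial of degree at most d, and let f denote its f-polynomial with respect to d. If (a, b) is the I_d-decomposition of h and (ã, b̃) is the R_d-decomposition of f, then ã = (1+x)^d·a(x/(1+x)) and b̃ = (1+x)^{d−1}·b(x/(1+x)); that is, ã is the f-polynomial of a with respect to d, and b̃ is the f-polynomial of b with respect to d−1. -/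
open Polynomial
open scoped Classical

theorem aux_rflip (d : ℕ) (a : ℝ[X]) (h : Polynomial.reflect d a = a) :
    Rflip d (fPoly d a) = fPoly d a := by
  unfold Rflip fPoly
  conv_rhs => rw [← Finset.sum_range_reflect]
  rw [Polynomial.sum_comp, Finset.smul_sum]
  refine Finset.sum_congr rfl fun k hk => ?_
  have hk' : k ≤ d := by
    have := Finset.mem_range.mp hk
    omega
  have hc : a.coeff (d - k) = a.coeff k := by
    conv_lhs => rw [← h]
    rw [Polynomial.coeff_reflect, Polynomial.revAt_le (Nat.sub_le d k), Nat.sub_sub_self hk']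
  have e1 : d + 1 - 1 - k = d - k := by omega
  rw [e1, hc, Nat.sub_sub_self hk', Polynomial.smul_eq_C_mul]
  simp only [mul_comp, pow_comp, C_comp, X_comp, add_comp, one_comp]
  obtain ⟨m, rfl⟩ := Nat.exists_eq_add_of_le hk'
  have e2 : k + m - k = m := by omega
  have e3 : (-1 - X : ℝ[X]) = (-1) * (1 + X) := by ring
  have e4 : (1 + (-1) * (1 + X) : ℝ[X]) = (-1) * X := by ring
  have e5 : ((-1 : ℝ[X]) ^ k) * (-1) ^ k = 1 := by rw [← mul_pow]; simp
  have e6 : ((-1 : ℝ[X]) ^ m) * (-1) ^ m = 1 := by rw [← mul_pow]; simp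
  rw [e2, e3, e4, mul_pow, mul_pow, C_pow, C_neg, C_1, pow_add]
  calc _ = (((-1 : ℝ[X]) ^ k) * (-1) ^ k) * (((-1 : ℝ[X]) ^ m) * (-1) ^ m)
        * (C (a.coeff k) * X ^ m * (1 + X) ^ k) := by ring
    _ = _ := by rw [e5, e6]; ring

theorem aux_add (n : ℕ) (a b : ℝ[X]) :
    fPoly (n + 1) (a + X * b) = fPoly (n + 1) a + X * fPoly n b := by
  unfold fPoly
  simp only [coeff_add, C_add, add_mul, Finset.sum_add_distrib]
  congr 1
  rw [Finset.sum_range_succ', Finset.mul_sum]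
  simp only [coeff_X_mul, mul_coeff_zero, coeff_X_zero, zero_mul, C_0, add_zero]
  refine Finset.sum_congr rfl fun k _ => ?_
  rw [Nat.add_sub_add_right]
  ring

/-- if `(a,b)` is the `I_d`-decomposition of `h` and `(ta, tb)` is the
`R_d`-decomposition of its f-polynomial `f = fPoly d h`, then `ta` is the
f-polynomial of `a` (w.r.t. `d`) and `tb` is the f-polynomial of `b` (w.r.t. `d-1`). -/
theorem stmt2 (d : ℕ) (h : ℝ[X]) (hdeg : h.degree ≤ (d : ℕ))
    (a b ta tb : ℝ[X])
    (hab : h = a + X * b) (ha : a.degree ≤ (d : ℕ)) (hb : b.degree < (d : ℕ))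
    (hra : Polynomial.reflect d a = a) (hrb : Polynomial.reflect (d - 1) b = b)
    (htab : fPoly d h = ta + X * tb) (hta : ta.degree ≤ (d : ℕ)) (htb : tb.degree < (d : ℕ))
    (hrta : Rflip d ta = ta) (hrtb : Rflip (d - 1) tb = tb) :
    ta = fPoly d a ∧ tb = fPoly (d - 1) b := by
  rcases d with _ | n
  · have hb0 : b = 0 := by
      by_contra hne
      exact absurd hb (not_lt.mpr (by simpa using zero_le_degree_iff.mpr hne))
    have ht0 : tb = 0 := by
      by_contra hne
      exact absurd htb (not_lt.mpr (by simpa using zero_le_degree_iff.mpr hne))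
    subst hb0 ht0
    simp only [mul_zero, add_zero] at hab htab
    subst hab
    exact ⟨htab.symm, by simp [fPoly]⟩
  · simp only [Nat.add_sub_cancel] at hrb hrtb ⊢
    rw [hab, aux_add] at htab
    have h1 := aux_rflip _ a hra
    have h2 := aux_rflip _ b hrb
    generalize fPoly (n + 1) a = A at *
    generalize fPoly n b = B at *
    unfold Rflip at h1 h2 hrta hrtb
    rw [smul_eq_C_mul] at h1 h2 hrta hrtb
    have hc := congrArg (fun p : ℝ[X] => p.comp (-1 - X)) htab
    simp only [add_comp, mul_comp, X_comp] at hc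
    rw [pow_succ, C_mul] at h1 hrta
    simp only [C_neg, C_1] at h1 hrta
    have hv : B - tb = 0 := by
      linear_combination (-C ((-1 : ℝ) ^ n)) * hc - h1 + hrta - (1 + X) * h2
        + (1 + X) * hrtb - htab
    have hB : B = tb := sub_eq_zero.mp hv
    subst hB
    exact ⟨(add_right_cancel htab).symm, rfl⟩
end

section
/- Let p ∈ ℝ[x] have degree at most d and I_d-decomposition (a, b), and suppose both a and b have only nonnegative coefficients. Then the following are equivalent: (1) b ≺ a; (2) a ≺ p; (3) b ≺ p; (4) I_d(p) ≺ p; (5) R_d(f) ≺ f, where f is the f-polynomial of p with respect to d. -/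
open Polynomial
open scoped Classical

open ComplexConjugate

/-- Product estimate over a multiset of points in the closed lower half-plane. -/
lemma aux_prod (z : ℂ) (hz : 0 < z.im) (M : Multiset ℂ) (hM : ∀ α ∈ M, α.im ≤ 0) :
    Complex.normSq ((M.map fun α => z - conj α).prod) ≤
        Complex.normSq ((M.map fun α => z - α).prod) ∧ M.sum.im ≤ 0 ∧
      z.im * Complex.normSq ((M.map fun α => z - α).prod - (M.map fun α => z - conj α).prod) ≤
        (-M.sum.im) * (Complex.normSq ((M.map fun α => z - α).prod) -
          Complex.normSq ((M.map fun α => z - conj α).prod)) := by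
  induction M using Multiset.induction with
  | empty => simp
  | cons α M ih =>
    obtain ⟨h1, h2, h3⟩ := ih fun β hβ => hM β (Multiset.mem_cons_of_mem hβ)
    have hα : α.im ≤ 0 := hM α (Multiset.mem_cons_self _ _)
    simp only [Multiset.map_cons, Multiset.prod_cons, Multiset.sum_cons]
    generalize (M.map fun α => z - α).prod = P at *
    generalize (M.map fun α => z - conj α).prod = Q at *
    generalize M.sum = S at *
    have huv : Complex.normSq (z - α) = Complex.normSq (z - conj α) + 4 * z.im * (-α.im) := by
      simp [Complex.normSq_apply]; ring
    have hv := Complex.normSq_nonneg (z - conj α)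
    have hu := Complex.normSq_nonneg (z - α)
    have hQ := Complex.normSq_nonneg Q
    have hzy : 0 ≤ 4 * z.im * (-α.im) := by
      have : 0 ≤ -α.im := by linarith
      positivity
    have hE : 0 ≤ Complex.normSq (z - α) * (Complex.normSq P - Complex.normSq Q) :=
      mul_nonneg hu (by linarith)
    have hF : 0 ≤ 4 * z.im * (-α.im) * Complex.normSq Q := mul_nonneg hzy hQ
    have hdiff : Complex.normSq ((z - α) * P) - Complex.normSq ((z - conj α) * Q) =
        Complex.normSq (z - α) * (Complex.normSq P - Complex.normSq Q) +
        4 * z.im * (-α.im) * Complex.normSq Q := by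
      rw [Complex.normSq_mul, Complex.normSq_mul]
      have : Complex.normSq (z - conj α) = Complex.normSq (z - α) - 4 * z.im * (-α.im) := by
        linarith
      rw [this]; ring
    refine ⟨by linarith, by simp; linarith, ?_⟩
    rw [hdiff]
    set E := Complex.normSq (z - α) * (Complex.normSq P - Complex.normSq Q) with hEd
    set F := 4 * z.im * (-α.im) * Complex.normSq Q with hFd
    have hA : z.im * (‖z - α‖ * ‖P - Q‖) ^ 2 ≤ (-S.im) * E := by
      rw [mul_pow, ← Complex.normSq_eq_norm_sq, ← Complex.normSq_eq_norm_sq]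
      have := mul_le_mul_of_nonneg_left h3 hu
      rw [hEd]; linarith
    have hC : z.im * (2 * (-α.im) * ‖Q‖) ^ 2 = (-α.im) * F := by
      rw [mul_pow, ← Complex.normSq_eq_norm_sq, hFd]; ring
    have hnorm : ‖(z - α) * P - (z - conj α) * Q‖ ≤
        ‖z - α‖ * ‖P - Q‖ + 2 * (-α.im) * ‖Q‖ := by
      have e : (z - α) * P - (z - conj α) * Q = (z - α) * (P - Q) + (conj α - α) * Q := by ring
      have e2 : ‖conj α - α‖ = 2 * (-α.im) := by
        have : conj α - α = ((2 * (-α.im) : ℝ) : ℂ) * Complex.I := by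
          apply Complex.ext <;> simp; ring
        rw [this, norm_mul, Complex.norm_I, mul_one, Complex.norm_real, Real.norm_eq_abs,
          abs_of_nonneg (by linarith)]
      rw [e, ← e2]
      exact (norm_add_le _ _).trans (by rw [norm_mul, norm_mul])
    rw [Complex.normSq_eq_norm_sq]
    have hsq : ‖(z - α) * P - (z - conj α) * Q‖ ^ 2 ≤
        (‖z - α‖ * ‖P - Q‖ + 2 * (-α.im) * ‖Q‖) ^ 2 :=
      pow_le_pow_left₀ (norm_nonneg _) hnorm 2
    set A := ‖z - α‖ * ‖P - Q‖
    set C' := 2 * (-α.im) * ‖Q‖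
    have hSn : 0 ≤ -S.im := by linarith
    have hαn : 0 ≤ -α.im := by linarith
    have hcross : 2 * (z.im * A * C') ≤ (-S.im) * F + (-α.im) * E := by
      have h4 : (z.im * A * C') ^ 2 ≤ ((-S.im) * F) * ((-α.im) * E) := by
        have := mul_le_mul_of_nonneg_right hA (mul_nonneg hαn hF)
        calc (z.im * A * C') ^ 2 = z.im * A ^ 2 * (z.im * C' ^ 2) := by ring
          _ = z.im * A ^ 2 * (-α.im * F) := by rw [hC]
          _ ≤ -S.im * E * (-α.im * F) := this
          _ = _ := by ring
      have h5 : 0 ≤ (-S.im) * F := mul_nonneg hSn hF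
      have h6 : 0 ≤ (-α.im) * E := mul_nonneg hαn hE
      generalize (-S.im) * F = x at *
      generalize (-α.im) * E = y at *
      apply le_of_sq_le_sq _ (by linarith)
      nlinarith [sq_nonneg (x - y)]
    have h7 := mul_le_mul_of_nonneg_left hsq hz.le
    have : (-(α + S).im) = -α.im + -S.im := by simp; ring
    rw [this]
    nlinarith

lemma eval_toC (p : ℝ[X]) (z : ℂ) : (toC p).eval z = aeval z p := by
  simp [toC, Polynomial.eval_map_algebraMap]

lemma coeff_g (p q : ℝ[X]) (n : ℕ) : (toC q + C Complex.I * toC p).coeff n =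
    (q.coeff n : ℂ) + Complex.I * (p.coeff n : ℂ) := by
  simp [toC]

lemma g_eq_zero (p q : ℝ[X]) : toC q + C Complex.I * toC p = 0 ↔ p = 0 ∧ q = 0 := by
  constructor
  · intro h
    have h' : ∀ n, (q.coeff n : ℂ) + Complex.I * (p.coeff n : ℂ) = 0 := by
      intro n; rw [← coeff_g, h]; simp
    constructor <;> ext n
    · simpa using congrArg Complex.im (h' n)
    · simpa using congrArg Complex.re (h' n)
  · rintro ⟨rfl, rfl⟩; simp [toC]

/-- pointwise form of interlacing -/
def GoodPair (p q : ℝ[X]) : Prop := ∀ z : ℂ, 0 < z.im →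
  0 ≤ (aeval z q * conj (aeval z p)).im ∧ ¬ (aeval z p = 0 ∧ aeval z q = 0)

lemma g_eval (p q : ℝ[X]) (z : ℂ) : (toC q + C Complex.I * toC p).eval z =
    aeval z q + Complex.I * aeval z p := by
  simp [eval_toC]

lemma g_prod (p q : ℝ[X]) (z : ℂ) :
    aeval z q + Complex.I * aeval z p = (toC q + C Complex.I * toC p).leadingCoeff *
      ((toC q + C Complex.I * toC p).roots.map fun α => z - α).prod ∧
    aeval z q - Complex.I * aeval z p = conj (toC q + C Complex.I * toC p).leadingCoeff *
      ((toC q + C Complex.I * toC p).roots.map fun α => z - conj α).prod := by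
  have key : ∀ w : ℂ, aeval w q + Complex.I * aeval w p =
      (toC q + C Complex.I * toC p).leadingCoeff *
      ((toC q + C Complex.I * toC p).roots.map fun α => w - α).prod := by
    intro w
    rw [← g_eval]
    conv_lhs => rw [(IsAlgClosed.splits (toC q + C Complex.I * toC p)).eq_prod_roots]
    rw [eval_mul, eval_C, eval_multiset_prod, Multiset.map_map]
    simp
  refine ⟨key z, ?_⟩
  have := congrArg conj (key (conj z))
  rw [map_add, map_mul, aeval_conj, aeval_conj, map_mul, Complex.conj_conj, Complex.conj_conj,
    Complex.conj_I, map_multiset_prod, Multiset.map_map] at this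
  simpa [sub_eq_add_neg] using this

lemma normSq_diff (x y : ℂ) : Complex.normSq (x + Complex.I * y) -
    Complex.normSq (x - Complex.I * y) = 4 * (x * conj y).im := by
  simp [Complex.normSq_apply]; ring

lemma interlaces_iff (p q : ℝ[X]) (h : ¬ (p = 0 ∧ q = 0)) : Interlaces p q ↔ GoodPair p q := by
  unfold Interlaces StableC
  rw [g_eq_zero, or_iff_right h]
  constructor
  · intro H z hz
    constructor
    · have hg0 : toC q + C Complex.I * toC p ≠ 0 := by rwa [Ne, g_eq_zero]
      obtain ⟨e1, e2⟩ := g_prod p q z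
      have hp := (aux_prod z hz (toC q + C Complex.I * toC p).roots (by
        intro α hα
        by_contra hc
        exact H α (by linarith) (isRoot_of_mem_roots hα))).1
      have := normSq_diff (aeval z q) (aeval z p)
      rw [e1, e2, Complex.normSq_mul, Complex.normSq_mul, Complex.normSq_conj] at this
      have := mul_le_mul_of_nonneg_left hp
        (Complex.normSq_nonneg (toC q + C Complex.I * toC p).leadingCoeff)
      linarith
    · rintro ⟨h1, h2⟩
      apply H z hz
      rw [g_eval, h1, h2]; simp
  · intro H z hz h0
    rw [g_eval] at h0
    obtain ⟨h1, h2⟩ := H z hz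
    have hq : aeval z q = -(Complex.I * aeval z p) := eq_neg_of_add_eq_zero_left h0
    have : (aeval z q * conj (aeval z p)).im = - Complex.normSq (aeval z p) := by
      rw [hq]; simp [Complex.normSq_apply]; ring
    rw [this] at h1
    have hp : aeval z p = 0 := by
      rw [← Complex.normSq_eq_zero]
      linarith [Complex.normSq_nonneg (aeval z p)]
    exact h2 ⟨hp, by rw [hq, hp]; simp⟩

/-- Hurwitz-type propagation step. -/
lemma step_good (s e f U V : ℂ) (h1 : 0 ≤ (s * U * conj V).im) (h2 : 0 ≤ (s * V * conj U).im)
    (h3 : 0 ≤ (s * e * conj f).im) (h4 : 0 ≤ (s * f * conj e).im) :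
    0 ≤ (s * (e * U + f * V) * conj (e * V + f * U)).im := by
  have : (s * (e * U + f * V) * conj (e * V + f * U)).im =
      Complex.normSq e * (s * U * conj V).im + Complex.normSq f * (s * V * conj U).im
      + Complex.normSq U * (s * e * conj f).im + Complex.normSq V * (s * f * conj e).im := by
    simp [Complex.normSq_apply]; ring
  rw [this]
  have := Complex.normSq_nonneg
  have a1 := mul_nonneg (this e) h1
  have a2 := mul_nonneg (this f) h2
  have a3 := mul_nonneg (this U) h3
  have a4 := mul_nonneg (this V) h4
  linarith

lemma hurwitz_good (s : ℂ) (hre : 0 < s.re) (him : 0 < s.im) (n : ℕ) :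
    ∀ K : ℝ[X], K.natDegree = n → K ≠ 0 → (∀ w : ℂ, aeval w K = 0 → w.re ≤ 0) →
    0 ≤ (s * (aeval s K + aeval (-s) K) * conj (aeval s K - aeval (-s) K)).im ∧
    0 ≤ (s * (aeval s K - aeval (-s) K) * conj (aeval s K + aeval (-s) K)).im := by
  induction n using Nat.strong_induction_on with
  | _ n ih =>
  intro K hn hK hr
  have hprod := mul_pos hre him
  -- multiplication step
  have main : ∀ (D L : ℝ[X]) (e f : ℂ), K = D * L → 0 < D.natDegree →
      aeval s D = e + f → aeval (-s) D = e - f → 0 ≤ (s * e * conj f).im →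
      0 ≤ (s * f * conj e).im →
      0 ≤ (s * (aeval s K + aeval (-s) K) * conj (aeval s K - aeval (-s) K)).im ∧
      0 ≤ (s * (aeval s K - aeval (-s) K) * conj (aeval s K + aeval (-s) K)).im := by
    intro D L e f hKD hD h1 h2 h3 h4
    have hL : L ≠ 0 := by rintro rfl; simp at hKD; exact hK hKD
    have hD0 : D ≠ 0 := by rintro rfl; simp at hD
    have hdeg : L.natDegree < n := by
      rw [← hn, hKD, natDegree_mul hD0 hL]; omega
    obtain ⟨g1, g2⟩ := ih _ hdeg L rfl hL (fun w hw => hr w (by rw [hKD, map_mul, hw, mul_zero]))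
    have eU : aeval s K + aeval (-s) K = e * (aeval s L + aeval (-s) L) +
        f * (aeval s L - aeval (-s) L) := by
      rw [hKD, map_mul, map_mul, h1, h2]; ring
    have eV : aeval s K - aeval (-s) K = e * (aeval s L - aeval (-s) L) +
        f * (aeval s L + aeval (-s) L) := by
      rw [hKD, map_mul, map_mul, h1, h2]; ring
    rw [eU, eV]
    exact ⟨step_good _ _ _ _ _ g1 g2 h3 h4, step_good _ _ _ _ _ g2 g1 h3 h4⟩
  by_cases hd : K.degree = 0
  · obtain ⟨c, rfl⟩ : ∃ c, K = C c := ⟨_, eq_C_of_degree_eq_zero hd⟩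
    simp
  · obtain ⟨w, hw⟩ := IsAlgClosed.exists_aeval_eq_zero ℂ K hd
    have hwre := hr w hw
    by_cases hwim : w.im = 0
    · have hroot : K.IsRoot w.re := by
        have hw' : w = ((w.re : ℝ) : ℂ) := by apply Complex.ext <;> simp [hwim]
        rw [hw'] at hw
        have : ((eval w.re K : ℝ) : ℂ) = 0 := by
          rw [← hw]
          exact (Polynomial.aeval_algebraMap_apply_eq_algebraMap_eval (A := ℂ) w.re K).symm
        exact_mod_cast this
      obtain ⟨L, hL⟩ := dvd_iff_isRoot.mpr hroot
      refine main (X - C w.re) L ((-w.re : ℝ) : ℂ) s hL (by simp) (by simp; ring) (by simp; ring)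
        ?_ ?_
      · simp; nlinarith
      · simp; nlinarith
    · obtain ⟨L, hL⟩ := quadratic_dvd_of_aeval_eq_zero_im_ne_zero K hw hwim
      have hdegq : (X ^ 2 - C (2 * w.re) * X + C (‖w‖ ^ 2) : ℝ[X]).natDegree = 2 := by
        compute_degree!
      refine main _ L (s ^ 2 + ((‖w‖ ^ 2 : ℝ) : ℂ)) (((-2 * w.re : ℝ) : ℂ) * s) hL (by omega)
        (by simp; ring) (by simp; ring) ?_ ?_
      · have : (s * (s ^ 2 + ((‖w‖ ^ 2 : ℝ) : ℂ)) * conj (((-2 * w.re : ℝ) : ℂ) * s)).im =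
          (-2 * w.re) * Complex.normSq s * (2 * (s.re * s.im)) := by
          simp only [map_mul, Complex.conj_ofReal, Complex.normSq_apply, Complex.mul_im,
            Complex.mul_re, Complex.add_re, Complex.add_im, pow_two, Complex.ofReal_re,
            Complex.ofReal_im, Complex.conj_re, Complex.conj_im]
          ring
        rw [this]
        have := Complex.normSq_nonneg s
        have : 0 ≤ -2 * w.re := by linarith
        positivity
      · have : (s * (((-2 * w.re : ℝ) : ℂ) * s) * conj (s ^ 2 + ((‖w‖ ^ 2 : ℝ) : ℂ))).im =
          (-2 * w.re) * ‖w‖ ^ 2 * (2 * (s.re * s.im)) := by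
          simp only [map_mul, map_add, Complex.conj_ofReal, Complex.mul_im,
            Complex.mul_re, Complex.add_re, Complex.add_im, pow_two, Complex.ofReal_re,
            Complex.ofReal_im, Complex.conj_re, Complex.conj_im]
          ring
        rw [this]
        have : 0 ≤ -2 * w.re := by linarith
        positivity

lemma nonneg_eval {q : ℝ[X]} (h : ∀ k, 0 ≤ q.coeff k) {x : ℝ} (hx : 0 < x) : 0 ≤ q.eval x := by
  rw [eval_eq_sum_range]
  exact Finset.sum_nonneg fun i _ => mul_nonneg (h i) (pow_nonneg hx.le _)

lemma eq_zero_of_nonneg_eval {q : ℝ[X]} (h : ∀ k, 0 ≤ q.coeff k) {x : ℝ} (hx : 0 < x)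
    (h0 : q.eval x = 0) : q = 0 := by
  rw [eval_eq_sum_range, Finset.sum_eq_zero_iff_of_nonneg
    (fun i _ => mul_nonneg (h i) (pow_nonneg hx.le _))] at h0
  have := h0 q.natDegree (by simp)
  have h2 : x ^ q.natDegree ≠ 0 := (pow_pos hx _).ne'
  simpa [h2] using this

/-- square roots in the first quadrant -/
lemma exists_sqrt (z : ℂ) (hz : 0 < z.im) : ∃ s : ℂ, 0 < s.re ∧ 0 < s.im ∧ s ^ 2 = z := by
  obtain ⟨s, hs⟩ := IsAlgClosed.exists_pow_nat_eq z (n := 2) (by norm_num)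
  have him : z.im = 2 * (s.re * s.im) := by rw [← hs]; simp [pow_two]; ring
  rcases lt_trichotomy s.re 0 with h | h | h
  · refine ⟨-s, by simpa using h, ?_, by simpa using hs⟩
    simp; nlinarith
  · rw [h] at him; linarith
  · refine ⟨s, h, ?_, hs⟩
    by_contra hc
    nlinarith

/-- If `a(s²) + s b(s²)` has no zero in the open first quadrant then `a, b` interlace pointwise. -/
lemma good_of_quadrant (a b : ℝ[X]) (h0 : ¬ (a = 0 ∧ b = 0)) (hanneg : ∀ k, 0 ≤ a.coeff k)
    (hbnneg : ∀ k, 0 ≤ b.coeff k)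
    (H : ∀ s : ℂ, 0 < s.re → 0 < s.im → aeval (s ^ 2) a + s * aeval (s ^ 2) b ≠ 0) :
    ∀ z : ℂ, 0 < z.im → 0 ≤ (aeval z a * conj (aeval z b)).im ∧
      0 ≤ (z * aeval z b * conj (aeval z a)).im := by
  intro z hz
  obtain ⟨s, hre, him, rfl⟩ := exists_sqrt z hz
  set K : ℝ[X] := expand ℝ 2 a + X * expand ℝ 2 b with hKd
  have hev : ∀ w : ℂ, aeval w K = aeval (w ^ 2) a + w * aeval (w ^ 2) b := by
    intro w; simp [hKd, expand_aeval]
  have hroots : ∀ w : ℂ, aeval w K = 0 → w.re ≤ 0 := by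
    intro w hw
    by_contra hc
    push Not at hc
    rcases lt_trichotomy w.im 0 with h | h | h
    · apply H (conj w) (by simpa using hc) (by simpa using h)
      rw [← hev, aeval_conj, hw, map_zero]
    · have hw' : w = ((w.re : ℝ) : ℂ) := by apply Complex.ext <;> simp [h]
      rw [hw'] at hw
      have h1 : eval w.re K = 0 := by
        have : ((eval w.re K : ℝ) : ℂ) = 0 := by
          rw [← hw]
          exact (Polynomial.aeval_algebraMap_apply_eq_algebraMap_eval (A := ℂ) w.re K).symm
        exact_mod_cast this
      have h2 : eval w.re K = eval (w.re ^ 2) a + w.re * eval (w.re ^ 2) b := by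
        simp [hKd, expand_eval]
      have ha := nonneg_eval hanneg (pow_pos hc 2)
      have hb := nonneg_eval hbnneg (pow_pos hc 2)
      have hb' := mul_nonneg hc.le hb
      rw [h2] at h1
      refine h0 ⟨eq_zero_of_nonneg_eval hanneg (pow_pos hc 2) (by linarith),
        eq_zero_of_nonneg_eval hbnneg (pow_pos hc 2) ?_⟩
      have : w.re * eval (w.re ^ 2) b = 0 := by linarith
      exact (mul_eq_zero.mp this).resolve_left hc.ne'
    · exact H w hc h (by rw [← hev, hw])
  have hK0 : K ≠ 0 := by
    intro h
    have := hroots 1 (by rw [h]; simp)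
    simp at this
    linarith
  obtain ⟨g1, g2⟩ := hurwitz_good s hre him _ K rfl hK0 hroots
  have eU : aeval s K + aeval (-s) K = 2 * aeval (s ^ 2) a := by
    rw [hev, hev, neg_sq]; ring
  have eV : aeval s K - aeval (-s) K = 2 * (s * aeval (s ^ 2) b) := by
    rw [hev, hev, neg_sq]; ring
  rw [eU, eV] at g1 g2
  generalize aeval (s ^ 2) a = A at *
  generalize aeval (s ^ 2) b = B at *
  have hs : 0 < Complex.normSq s := by
    rw [Complex.normSq_pos]; rintro rfl; simp at hre
  constructor
  · have : (s * (2 * A) * conj (2 * (s * B))).im = 4 * Complex.normSq s * (A * conj B).im := by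
      simp [Complex.normSq_apply]; ring
    rw [this] at g1
    exact nonneg_of_mul_nonneg_right g1 (by positivity)
  · have : (s * (2 * (s * B)) * conj (2 * A)).im = 4 * (s ^ 2 * B * conj A).im := by
      simp [pow_two]; ring
    rw [this] at g2
    linarith

/-- The Julia-type step. -/
lemma good_of_b_p (a b : ℝ[X]) (hb : b ≠ 0) (hanneg : ∀ k, 0 ≤ a.coeff k)
    (hbnneg : ∀ k, 0 ≤ b.coeff k) (H : Interlaces b (a + X * b)) (z : ℂ) (hz : 0 < z.im) :
    0 ≤ (aeval z a * conj (aeval z b)).im := by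
  set p := a + X * b with hpd
  have hpc : ∀ n, p.coeff (n + 1) = a.coeff (n + 1) + b.coeff n := by
    intro n; simp [hpd, coeff_X_mul]
  have hlead : 0 < b.leadingCoeff :=
    lt_of_le_of_ne (hbnneg _) (Ne.symm (leadingCoeff_ne_zero.mpr hb))
  have hdeg : b.natDegree < p.natDegree := by
    have : p.coeff (b.natDegree + 1) ≠ 0 := by
      rw [hpc]
      have := hanneg (b.natDegree + 1)
      have h2 : b.coeff b.natDegree = b.leadingCoeff := rfl
      rw [h2]; linarith
    exact le_natDegree_of_ne_zero this
  obtain ⟨m, hm⟩ : ∃ m, p.natDegree = m + 1 := ⟨p.natDegree - 1, by omega⟩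
  set g := toC p + C Complex.I * toC b with hg
  have hp0 : p ≠ 0 := by rintro h; rw [h] at hdeg; simp at hdeg
  have hgc : ∀ n, g.coeff n = (p.coeff n : ℂ) + Complex.I * (b.coeff n : ℂ) := coeff_g b p
  have hgm : g.coeff (m + 1) = (p.coeff (m + 1) : ℂ) := by
    rw [hgc, coeff_eq_zero_of_natDegree_lt (p := b) (by omega)]; simp
  have hpm0 : p.coeff (m + 1) ≠ 0 := by
    rw [← hm]; exact leadingCoeff_ne_zero.mpr hp0
  have hpm : 0 < p.coeff (m + 1) := by
    refine lt_of_le_of_ne ?_ (Ne.symm hpm0)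
    rw [hpc]; exact add_nonneg (hanneg _) (hbnneg _)
  have hgdeg : g.natDegree = m + 1 := by
    apply le_antisymm
    · rw [natDegree_le_iff_coeff_eq_zero]
      intro N hN
      rw [hgc, coeff_eq_zero_of_natDegree_lt (p := b) (by omega),
        coeff_eq_zero_of_natDegree_lt (p := p) (by omega)]
      simp
    · apply le_natDegree_of_ne_zero
      rw [hgm]; exact_mod_cast hpm0
  have hgl : g.leadingCoeff = (p.coeff (m + 1) : ℂ) := by
    rw [leadingCoeff, hgdeg, hgm]
  have hnext := (IsAlgClosed.splits g).nextCoeff_eq_neg_sum_roots_mul_leadingCoeff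
  rw [nextCoeff_of_natDegree_pos (by omega), hgdeg, hgl] at hnext
  have hY : p.coeff (m + 1) * (-g.roots.sum.im) = b.coeff m := by
    have := congrArg Complex.im hnext
    rw [Nat.add_sub_cancel, hgc] at this
    simp at this
    linarith
  have hY1 : -g.roots.sum.im ≤ 1 := by
    by_contra hc
    push Not at hc
    have h1 := mul_lt_mul_of_pos_left hc hpm
    rw [hY] at h1
    have := hpc m
    linarith [hanneg (m + 1)]
  have hstab : ∀ w : ℂ, 0 < w.im → g.eval w ≠ 0 := by
    rcases H with h | h
    · exact absurd ((g_eq_zero b p).mp h).1 hb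
    · exact h
  obtain ⟨h1, -, h3⟩ := aux_prod z hz g.roots (by
        intro α hα
        by_contra hc
        exact hstab α (by linarith) (isRoot_of_mem_roots hα))
  obtain ⟨e1, e2⟩ := g_prod b p z
  rw [← hg, hgl] at e1 e2
  rw [Complex.conj_ofReal] at e2
  have hd := normSq_diff (aeval z p) (aeval z b)
  rw [e1, e2] at hd
  have hs : 2 * Complex.I * aeval z b = (p.coeff (m + 1) : ℂ) *
      ((g.roots.map fun α => z - α).prod - (g.roots.map fun α => z - conj α).prod) := by
    rw [mul_sub, ← e1, ← e2]; ring
  have hs2 := congrArg Complex.normSq hs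
  generalize (g.roots.map fun α => z - α).prod = P at *
  generalize (g.roots.map fun α => z - conj α).prod = Q at *
  simp only [Complex.normSq_mul, Complex.normSq_I, Complex.normSq_ofReal, Complex.normSq_ofNat]
    at hs2 hd
  have hpe : aeval z p = aeval z a + z * aeval z b := by simp [hpd]
  have hfin : (aeval z p * conj (aeval z b)).im = (aeval z a * conj (aeval z b)).im +
      z.im * Complex.normSq (aeval z b) := by
    rw [hpe]; simp [Complex.normSq_apply]; ring
  have h4 : z.im * Complex.normSq (P - Q) ≤ Complex.normSq P - Complex.normSq Q := by
    nlinarith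
  have h5 := mul_le_mul_of_nonneg_left h4 (mul_self_nonneg (p.coeff (m + 1)))
  have h6 : p.coeff (m + 1) * p.coeff (m + 1) * (z.im * Complex.normSq (P - Q)) =
      z.im * (4 * Complex.normSq (aeval z b)) := by
    have : p.coeff (m + 1) * p.coeff (m + 1) * Complex.normSq (P - Q) =
      4 * Complex.normSq (aeval z b) := by rw [← hs2]; ring
    rw [← this]; ring
  linarith

lemma eq_zero_of_upper (f : ℂ[X]) (h : ∀ z : ℂ, 0 < z.im → f.eval z = 0) : f = 0 := by
  apply eq_zero_of_infinite_isRoot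
  refine Set.infinite_of_injective_forall_mem (f := fun n : ℕ => ((n : ℂ) + 1) * Complex.I) ?_ ?_
  · intro m n hmn
    have := congrArg Complex.im hmn
    simpa using this
  · intro n
    apply h
    simp
    positivity

lemma Rflip_fPoly (d : ℕ) (p : ℝ[X]) : Rflip d (fPoly d p) = fPoly d (reflect d p) := by
  unfold Rflip fPoly
  rw [← Finset.sum_range_reflect, ← Polynomial.coe_compRingHom_apply, map_sum, Finset.smul_sum]
  apply Finset.sum_congr rfl
  intro k hk
  have hk' : k ≤ d := by simpa [Nat.lt_succ_iff] using hk
  have e1 : d + 1 - 1 - k = d - k := by omega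
  have e2 : d - (d - k) = k := by omega
  rw [e1, e2, coeff_reflect, revAt_le hk', Polynomial.coe_compRingHom_apply]
  simp only [mul_comp, C_comp, pow_comp, X_comp, add_comp, one_comp]
  have h1 : (-1 - X : ℝ[X]) = (-1) * (1 + X) := by ring
  have h2 : (1 + (-1) * (1 + X) : ℝ[X]) = (-1) * X := by ring
  rw [h1, h2, mul_pow, mul_pow, smul_eq_C_mul]
  have h3 : (C ((-1 : ℝ) ^ d)) * ((-1 : ℝ[X]) ^ (d - k) * (-1) ^ k) = 1 := by
    rw [← pow_add, Nat.sub_add_cancel hk', C_pow, C_neg, C_1, ← mul_pow]; simp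
  linear_combination (C (p.coeff (d - k)) * (1 + X) ^ (d - k) * X ^ k) * h3

lemma fPoly_aeval (d : ℕ) (p : ℝ[X]) (hp : p.natDegree ≤ d) (z : ℂ) (hz : 1 + z ≠ 0) :
    aeval z (fPoly d p) = (1 + z) ^ d * aeval (z / (1 + z)) p := by
  unfold fPoly
  rw [aeval_eq_sum_range' (Nat.lt_succ_of_le hp), map_sum, Finset.mul_sum]
  apply Finset.sum_congr rfl
  intro k hk
  have hk' : k ≤ d := by simpa [Nat.lt_succ_iff] using hk
  obtain ⟨j, rfl⟩ := Nat.exists_eq_add_of_le hk'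
  simp only [map_mul, map_pow, aeval_C, aeval_X, map_add, map_one, Algebra.smul_def,
    Nat.add_sub_cancel_left, div_pow, pow_add]
  field_simp

lemma four_iff_five (d : ℕ) (p : ℝ[X]) (hp : p.natDegree ≤ d)
    (hr : (reflect d p).natDegree ≤ d) (h0 : p ≠ 0) :
    Interlaces (reflect d p) p ↔ Interlaces (Rflip d (fPoly d p)) (fPoly d p) := by
  rw [Rflip_fPoly]
  have key : ∀ z : ℂ, 1 + z ≠ 0 →
      (toC (fPoly d p) + C Complex.I * toC (fPoly d (reflect d p))).eval z =
      (1 + z) ^ d * (toC p + C Complex.I * toC (reflect d p)).eval (z / (1 + z)) := by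
    intro z hz
    rw [g_eval, g_eval, fPoly_aeval d p hp z hz, fPoly_aeval d _ hr z hz]; ring
  have hne : ∀ z : ℂ, 0 < z.im → 1 + z ≠ 0 := by
    intro z hz h
    have := congrArg Complex.im h
    simp at this; linarith
  have hmap : ∀ z : ℂ, 0 < z.im → 0 < (z / (1 + z)).im := by
    intro z hz
    have h := Complex.normSq_pos.mpr (hne z hz)
    have : (z / (1 + z)).im = z.im / Complex.normSq (1 + z) := by
      rw [Complex.div_im]; simp; field_simp; ring
    rw [this]; positivity
  have hinv : ∀ w : ℂ, 0 < w.im → ∃ z : ℂ, 0 < z.im ∧ z / (1 + z) = w := by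
    intro w hw
    have h1 : 1 - w ≠ 0 := by
      intro h
      have := congrArg Complex.im h
      simp at this; linarith
    refine ⟨w / (1 - w), ?_, ?_⟩
    · have h := Complex.normSq_pos.mpr h1
      have : (w / (1 - w)).im = w.im / Complex.normSq (1 - w) := by
        rw [Complex.div_im]; simp; field_simp; ring
      rw [this]; positivity
    · have : 1 + w / (1 - w) = 1 / (1 - w) := by field_simp; ring
      rw [this]; field_simp
  unfold Interlaces StableC
  constructor
  · rintro (h | h)
    · exact absurd ((g_eq_zero _ _).mp h).2 h0
    · right
      intro z hz
      rw [key z (hne z hz)]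
      exact mul_ne_zero (pow_ne_zero _ (hne z hz)) (h _ (hmap z hz))
  · rintro (h | h)
    · left
      apply eq_zero_of_upper
      intro w hw
      obtain ⟨z, hz, rfl⟩ := hinv w hw
      have := key z (hne z hz)
      rw [h, eval_zero] at this
      exact (mul_eq_zero.mp this.symm).resolve_left (pow_ne_zero _ (hne z hz))
    · right
      intro w hw h1
      obtain ⟨z, hz, rfl⟩ := hinv w hw
      apply h z hz
      rw [key z (hne z hz), h1, mul_zero]

lemma reflect_p (d : ℕ) (a b : ℝ[X]) (hb : b.degree < (d : ℕ))
    (hra : Polynomial.reflect d a = a) (hrb : Polynomial.reflect (d - 1) b = b) :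
    reflect d (a + X * b) = a + b := by
  rw [reflect_add, hra]
  congr 1
  rcases d with _ | n
  · have : b = 0 := by
      rw [← degree_eq_bot]; simpa using hb
    simp [this]
  · by_cases h0 : b = 0
    · simp [h0]
    have hbn : b.natDegree ≤ n := by
      have := (natDegree_lt_iff_degree_lt h0).mpr hb
      omega
    rw [Nat.add_comm, reflect_mul X b (by simp) hbn, reflect_one_X, one_mul]
    exact hrb

/-- Theorem on equivalent interlacing conditions: for `p` of degree
at most `d` with `I_d`-decomposition `(a,b)` having nonnegative coefficients, the
following are equivalent: (1) `b ≺ a`; (2) `a ≺ p`; (3) `b ≺ p`; (4) `I_d(p) ≺ p`;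
(5) `R_d(f) ≺ f` where `f` is the f-polynomial of `p` w.r.t. `d`. -/
theorem stmt3 (d : ℕ) (p a b : ℝ[X]) (hp : p.degree ≤ (d : ℕ))
    (hab : p = a + X * b) (ha : a.degree ≤ (d : ℕ)) (hb : b.degree < (d : ℕ))
    (hra : Polynomial.reflect d a = a) (hrb : Polynomial.reflect (d - 1) b = b)
    (hanneg : ∀ k, 0 ≤ a.coeff k) (hbnneg : ∀ k, 0 ≤ b.coeff k) :
    [Interlaces b a,
     Interlaces a p,
     Interlaces b p,
     Interlaces (Polynomial.reflect d p) p,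
     Interlaces (Rflip d (fPoly d p)) (fPoly d p)].TFAE := by
  by_cases h00 : a = 0 ∧ b = 0
  · obtain ⟨rfl, rfl⟩ := h00
    have hp0 : p = 0 := by simpa using hab
    subst hp0
    have h1 : fPoly d 0 = 0 := by simp [fPoly]
    have h2 : Rflip d 0 = 0 := by simp [Rflip]
    have h3 : Interlaces 0 0 := Or.inl (by simp [toC])
    rw [h1, h2, reflect_zero]
    tfae_have 1 → 2 := id
    tfae_have 2 → 3 := id
    tfae_have 3 → 4 := id
    tfae_have 4 → 5 := id
    tfae_have 5 → 1 := id
    tfae_finish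
  have hrp : reflect d p = a + b := by rw [hab]; exact reflect_p d a b hb hra hrb
  have hpc : ∀ n, p.coeff (n + 1) = a.coeff (n + 1) + b.coeff n := by
    intro n; simp [hab, coeff_X_mul]
  have hp0 : p ≠ 0 := by
    intro h
    have hev : eval 1 a + eval 1 b = 0 := by
      have := congrArg (eval 1) h
      rw [hab] at this
      simpa using this
    have e1 := nonneg_eval hanneg one_pos
    have e2 := nonneg_eval hbnneg one_pos
    exact h00 ⟨eq_zero_of_nonneg_eval hanneg one_pos (by linarith),
      eq_zero_of_nonneg_eval hbnneg one_pos (by linarith)⟩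
  have hpe : ∀ z : ℂ, aeval z p = aeval z a + z * aeval z b := by intro z; simp [hab]
  have hre : ∀ z : ℂ, aeval z (reflect d p) = aeval z a + aeval z b := by
    intro z; simp [hrp]
  have hpn : p.natDegree ≤ d := natDegree_le_of_degree_le hp
  have hrn : (reflect d p).natDegree ≤ d := by
    rw [hrp]
    apply natDegree_le_of_degree_le
    exact (degree_add_le _ _).trans (max_le ha hb.le)
  have hab0 : ¬ (b = 0 ∧ a = 0) := fun h => h00 ⟨h.2, h.1⟩
  have i1 := interlaces_iff b a hab0
  have i2 := interlaces_iff a p (fun h => hp0 h.2)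
  have i3 := interlaces_iff b p (fun h => hp0 h.2)
  have i4 := interlaces_iff (reflect d p) p (fun h => hp0 h.2)
  have full : ∀ (_ : ∀ s : ℂ, 0 < s.re → 0 < s.im → aeval (s ^ 2) a + s * aeval (s ^ 2) b ≠ 0)
      (z : ℂ), 0 < z.im → 0 ≤ (aeval z a * conj (aeval z b)).im ∧
      0 ≤ (z * aeval z b * conj (aeval z a)).im :=
    fun H => good_of_quadrant a b h00 hanneg hbnneg H
  have sq_im : ∀ s : ℂ, 0 < s.re → 0 < s.im → 0 < (s ^ 2).im := by
    intro s h1 h2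
    have : (s ^ 2).im = 2 * (s.re * s.im) := by simp [pow_two]; ring
    rw [this]; positivity
  have vanish : ∀ (x : ℂ) (r : ℝ), 0 < r → 0 ≤ -r * Complex.normSq x → x = 0 := by
    intro x r hr h
    rw [← Complex.normSq_eq_zero]
    have := Complex.normSq_nonneg x
    nlinarith
  have q1 : GoodPair b a →
      ∀ s : ℂ, 0 < s.re → 0 < s.im → aeval (s ^ 2) a + s * aeval (s ^ 2) b ≠ 0 := by
    intro G s h1 h2 h
    obtain ⟨g1, g2⟩ := G (s ^ 2) (sq_im s h1 h2)
    have e : aeval (s ^ 2) a = -(s * aeval (s ^ 2) b) := eq_neg_of_add_eq_zero_left h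
    have hb0 : aeval (s ^ 2) b = 0 := by
      apply vanish _ s.im h2
      convert g1 using 1
      rw [e]; simp [Complex.normSq_apply]; ring
    exact g2 ⟨hb0, by rw [e, hb0]; simp⟩
  have q2 : GoodPair a p →
      ∀ s : ℂ, 0 < s.re → 0 < s.im → aeval (s ^ 2) a + s * aeval (s ^ 2) b ≠ 0 := by
    intro G s h1 h2 h
    obtain ⟨g1, g2⟩ := G (s ^ 2) (sq_im s h1 h2)
    have e : aeval (s ^ 2) a = -(s * aeval (s ^ 2) b) := eq_neg_of_add_eq_zero_left h
    rw [hpe] at g1 g2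
    have hs : 0 < Complex.normSq s := by
      rw [Complex.normSq_pos]; rintro rfl; simp at h1
    have hb0 : aeval (s ^ 2) b = 0 := by
      apply vanish _ (s.im * Complex.normSq s) (by positivity)
      convert g1 using 1
      rw [e]; simp [Complex.normSq_apply, pow_two]; ring
    exact g2 ⟨by rw [e, hb0]; simp, by rw [e, hb0]; simp⟩
  have q4 : GoodPair (reflect d p) p →
      ∀ s : ℂ, 0 < s.re → 0 < s.im → aeval (s ^ 2) a + s * aeval (s ^ 2) b ≠ 0 := by
    intro G s h1 h2 h
    obtain ⟨g1, g2⟩ := G (s ^ 2) (sq_im s h1 h2)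
    have e : aeval (s ^ 2) p = -(s * aeval (s ^ 2) (reflect d p)) := by
      rw [hpe, hre]; linear_combination (1 + s) * h
    have hb0 : aeval (s ^ 2) (reflect d p) = 0 := by
      apply vanish _ s.im h2
      convert g1 using 1
      rw [e]; simp [Complex.normSq_apply]; ring
    exact g2 ⟨hb0, by rw [e, hb0]; simp⟩
  tfae_have 1 → 2 := by
    rw [i1, i2]
    intro G z hz
    obtain ⟨-, f2⟩ := full (q1 G) z hz
    obtain ⟨-, g2⟩ := G z hz
    have hz0 : z ≠ 0 := by rintro rfl; simp at hz
    rw [hpe]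
    constructor
    · convert f2 using 1
      simp; ring
    · rintro ⟨c1, c2⟩
      rw [c1] at c2
      exact g2 ⟨by simpa [hz0] using c2, c1⟩
  tfae_have 2 → 4 := by
    rw [i2, i4]
    intro G z hz
    obtain ⟨f1, f2⟩ := full (q2 G) z hz
    obtain ⟨-, g2⟩ := G z hz
    have hz1 : z - 1 ≠ 0 := by
      intro h
      have := congrArg Complex.im h
      simp at this; linarith
    rw [hpe, hre]
    rw [hpe] at g2
    constructor
    · have : ((aeval z a + z * aeval z b) * conj (aeval z a + aeval z b)).im =
        (aeval z a * conj (aeval z b)).im + (z * aeval z b * conj (aeval z a)).im +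
        z.im * Complex.normSq (aeval z b) := by
        simp [Complex.normSq_apply]; ring
      rw [this]
      have := mul_nonneg hz.le (Complex.normSq_nonneg (aeval z b))
      linarith
    · rintro ⟨c1, c2⟩
      have hb0 : aeval z b = 0 := by
        have : (z - 1) * aeval z b = 0 := by linear_combination c2 - c1
        exact (mul_eq_zero.mp this).resolve_left hz1
      exact g2 ⟨by simpa [hb0] using c1, c2⟩
  tfae_have 4 → 3 := by
    rw [i4, i3]
    intro G z hz
    obtain ⟨f1, f2⟩ := full (q4 G) z hz
    obtain ⟨-, g2⟩ := G z hz
    rw [hpe]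
    rw [hpe, hre] at g2
    constructor
    · have : ((aeval z a + z * aeval z b) * conj (aeval z b)).im =
        (aeval z a * conj (aeval z b)).im + z.im * Complex.normSq (aeval z b) := by
        simp [Complex.normSq_apply]; ring
      rw [this]
      have := mul_nonneg hz.le (Complex.normSq_nonneg (aeval z b))
      linarith
    · rintro ⟨c1, c2⟩
      have ha0 : aeval z a = 0 := by simpa [c1] using c2
      exact g2 ⟨by simp [ha0, c1], c2⟩
  tfae_have 3 → 1 := by
    intro H
    have G := i3.mp H
    rw [i1]
    intro z hz
    obtain ⟨-, g2⟩ := G z hz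
    constructor
    · by_cases hb0 : b = 0
      · simp [hb0]
      · exact good_of_b_p a b hb0 hanneg hbnneg (hab ▸ H) z hz
    · rintro ⟨c1, c2⟩
      exact g2 ⟨c1, by rw [hpe, c1, c2]; simp⟩
  tfae_have 4 ↔ 5 := four_iff_five d p hpn hrn hp0
  tfae_finish
end

section
/- Suppose i ∈ ℝ[x] is a polynomial of degree d and h ∈ ℝ[x] is the polynomial of degree at most d determined by the formal power series identity Σ_{m≥0} i(m)·x^m = h(x)/(1−x)^{d+1}. Then E(i)(x) = f(h; x), where the f-polynomial of h is computed with respect to degree d. -/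
open Polynomial
open scoped Classical

theorem aux_delta (n : ℕ) (a : ℕ → ℝ) (p : ℝ[X])
    (hp : ∀ m : ℕ, p.eval (m : ℝ) = ∑ t ∈ Finset.range n, a t * (m.choose t : ℝ)) (j : ℕ) :
    ∀ m : ℕ, ((fun q : ℝ[X] => q.comp (X + 1) - q)^[j] p).eval (m : ℝ) =
      ∑ t ∈ Finset.range n, a t * (if j ≤ t then (m.choose (t - j) : ℝ) else 0) := by
  induction j with
  | zero => intro m; simpa using hp m
  | succ j ih =>
    intro m
    rw [Function.iterate_succ_apply']
    have h1 := ih (m + 1)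
    push_cast at h1
    simp only [eval_sub, eval_comp, eval_add, eval_X, eval_one]
    rw [h1, ih m, ← Finset.sum_sub_distrib]
    refine Finset.sum_congr rfl fun t _ => ?_
    rw [← mul_sub]
    congr 1
    rcases lt_trichotomy t j with h | h | h
    · rw [if_neg (by omega), if_neg (by omega), if_neg (by omega)]; simp
    · subst h; simp
    · rw [if_pos (by omega), if_pos (by omega), if_pos (by omega)]
      obtain ⟨u, rfl⟩ : ∃ u, t = j + 1 + u := ⟨t - (j + 1), by omega⟩
      have e1 : j + 1 + u - j = u + 1 := by omega
      have e2 : j + 1 + u - (j + 1) = u := by omega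
      rw [e1, e2, Nat.choose_succ_succ]
      push_cast; ring

theorem aux_vander (d k m : ℕ) (hk : k ≤ d) :
    (m + d - k).choose d =
      ∑ t ∈ Finset.range (d + 1), m.choose t * (d - k).choose (d - t) := by
  rw [show m + d - k = m + (d - k) by omega, Nat.add_choose_eq,
    Finset.Nat.sum_antidiagonal_eq_sum_range_succ_mk]

theorem aux_coeff (d k : ℕ) (hk : k ≤ d) :
    (X ^ k * (1 + X) ^ (d - k) : ℝ[X]) =
      ∑ t ∈ Finset.range (d + 1), C ((d - k).choose (d - t) : ℝ) * X ^ t := by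
  ext n
  rw [coeff_X_pow_mul', coeff_one_add_X_pow, finset_sum_coeff]
  simp only [coeff_C_mul_X_pow, Finset.sum_ite_eq, Finset.mem_range]
  by_cases h1 : k ≤ n
  · by_cases h2 : n < d + 1
    · rw [if_pos h1, if_pos h2, ← Nat.choose_symm (by omega : n - k ≤ d - k)]
      congr 2; omega
    · rw [if_pos h1, if_neg h2, Nat.choose_eq_zero_of_lt (by omega)]; simp
  · rw [if_neg h1, if_pos (by omega), Nat.choose_eq_zero_of_lt (by omega)]; simp

/-- subdivision operator lemma: if `i` has degree `d` and
`Σ_{m≥0} i(m)x^m = h(x)/(1-x)^{d+1}` (equivalently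
`i(m) = Σ_{k=0}^d h_k·binom(m-k+d, d)` for all `m ≥ 0`), then `E(i) = f(h; x)`,
the f-polynomial of `h` w.r.t. degree `d`. -/
theorem stmt4 (d : ℕ) (i h : ℝ[X]) (hi : i.degree = (d : ℕ)) (hdeg : h.degree ≤ (d : ℕ))
    (hser : ∀ m : ℕ,
      i.eval (m : ℝ) = ∑ k ∈ Finset.range (d + 1), h.coeff k * ((m + d - k).choose d : ℝ)) :
    subdivE i = fPoly d h := by
  have hn : i.natDegree = d := natDegree_eq_of_degree_eq_some hi
  have key := aux_delta (d + 1)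
    (fun t => ∑ k ∈ Finset.range (d + 1), h.coeff k * ((d - k).choose (d - t) : ℝ)) i (by
      intro m
      rw [hser m]
      simp only [Finset.sum_mul]
      rw [Finset.sum_comm]
      refine Finset.sum_congr rfl fun k hk => ?_
      rw [aux_vander d k m (by have := Finset.mem_range.1 hk; omega)]
      push_cast
      rw [Finset.mul_sum]
      refine Finset.sum_congr rfl fun t _ => ?_
      ring)
  have key0 : ∀ j ∈ Finset.range (d + 1),
      ((fun q : ℝ[X] => q.comp (X + 1) - q)^[j] i).eval 0 =
        ∑ k ∈ Finset.range (d + 1), h.coeff k * ((d - k).choose (d - j) : ℝ) := by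
    intro j hj
    have := key j 0
    rw [Nat.cast_zero] at this
    rw [this, Finset.sum_eq_single_of_mem j hj]
    · simp
    · intro t _ ht
      by_cases hjt : j ≤ t
      · rw [if_pos hjt, Nat.choose_eq_zero_of_lt (by omega)]; simp
      · rw [if_neg hjt, mul_zero]
  unfold subdivE fPoly
  rw [hn, Finset.sum_congr rfl fun j hj => by rw [key0 j hj]]
  have e : ∀ k ∈ Finset.range (d + 1), C (h.coeff k) * X ^ k * (1 + X) ^ (d - k) =
      ∑ t ∈ Finset.range (d + 1), C (h.coeff k * ((d - k).choose (d - t) : ℝ)) * X ^ t := by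
    intro k hk
    rw [mul_assoc, aux_coeff d k (by have := Finset.mem_range.1 hk; omega), Finset.mul_sum]
    refine Finset.sum_congr rfl fun t _ => ?_
    rw [C_mul, mul_assoc]
  rw [Finset.sum_congr rfl e, Finset.sum_comm]
  refine Finset.sum_congr rfl fun t _ => ?_
  rw [map_sum, Finset.sum_mul]
end

section
/- The interlacing relation ≺ is transitive on nonzero elements of E_d: if f, g, h ∈ E_d are nonzero polynomials with f ≺ g and g ≺ h, then f ≺ h. -/
open Polynomial
open scoped Classical

open scoped ComplexConjugate

lemma im_sum_mul (c : ℂ) (w : ℕ → ℂ) (s t : Finset ℕ)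
    (h : ∀ i ∈ s, ∀ j ∈ t, 0 ≤ (c * (w i * conj (w j))).im) :
    0 ≤ (c * ((∑ i ∈ s, w i) * conj (∑ j ∈ t, w j))).im := by
  rw [map_sum, Finset.sum_mul_sum, Finset.mul_sum, Complex.im_sum]
  refine Finset.sum_nonneg fun i hi => ?_
  rw [Finset.mul_sum, Complex.im_sum]
  exact Finset.sum_nonneg fun j hj => h i hi j hj

structure GoodSeq (z : ℂ) (n : ℕ) (w : ℕ → ℂ) : Prop where
  ne : ∀ j ≤ n, w j ≠ 0
  A : ∀ i j, i ≤ j → j ≤ n → 0 ≤ (w j * conj (w i)).im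
  B : ∀ i j, i ≤ j → j ≤ n → 0 ≤ (z * conj (z + 1) * (w i * conj (w j))).im

lemma GoodSeq.C {z : ℂ} {n : ℕ} {w : ℕ → ℂ} (hw : GoodSeq z n w) (i j : ℕ) (hij : i ≤ j)
    (hj : j ≤ n) : 0 ≤ ((z + 1) * (w j * conj (w i))).im := by
  have h1 := hw.A i j hij hj
  have h2 := hw.B i j hij hj
  have h3 : ((z + 1) * (w j * conj (w i))).im
      = Complex.normSq (z + 1) * (w j * conj (w i)).im
        + (z * conj (z + 1) * (w i * conj (w j))).im := by
    simp [Complex.normSq_apply]; ring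
  rw [h3]
  have := Complex.normSq_nonneg (z + 1)
  positivity

lemma GoodSeq.Cpos {z : ℂ} (hz : 0 < z.im) {n : ℕ} {w : ℕ → ℂ} (hw : GoodSeq z n w) (j : ℕ)
    (hj : j ≤ n) : 0 < ((z + 1) * (w j * conj (w 0))).im := by
  have h1 := hw.A 0 j (Nat.zero_le _) hj
  have h2 := hw.B 0 j (Nat.zero_le _) hj
  have h3 : ((z + 1) * (w j * conj (w 0))).im
      = Complex.normSq (z + 1) * (w j * conj (w 0)).im
        + (z * conj (z + 1) * (w 0 * conj (w j))).im := by
    simp [Complex.normSq_apply]; ring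
  have hz1 : 0 < Complex.normSq (z + 1) := by
    rw [Complex.normSq_pos]
    intro h
    have := congrArg Complex.im h
    simp at this; linarith
  refine lt_of_le_of_ne (hw.C 0 j (Nat.zero_le _) hj) fun h0 => ?_
  rw [h3] at h0
  have h4 : (w j * conj (w 0)).im = 0 := by
    by_contra hne
    have : 0 < (w j * conj (w 0)).im := lt_of_le_of_ne h1 (Ne.symm hne)
    have := mul_pos hz1 this
    linarith
  have h5 : (z * conj (z + 1) * (w 0 * conj (w j))).im = 0 := by
    rw [h4] at h0; linarith
  have h6 : (w 0 * conj (w j)) = conj (w j * conj (w 0)) := by simp [mul_comm]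
  have h7 : w j * conj (w 0) ≠ 0 := by
    simp [hw.ne j hj, hw.ne 0 (Nat.zero_le _)]
  rw [h6] at h5
  generalize w j * conj (w 0) = u at *
  apply h7
  apply Complex.ext
  · simp [h4] at h5
    rcases h5 with h5 | h5
    · exfalso; nlinarith
    · simpa using h5
  · simpa using h4

lemma GoodSeq.D {z : ℂ} {n : ℕ} {w : ℕ → ℂ} (hw : GoodSeq z n w) (i j : ℕ) (hij : i ≤ j)
    (hj : j ≤ n) : 0 ≤ (z * (w i * conj (w j))).im := by
  have h1 := hw.A i j hij hj
  have h2 := hw.B i j hij hj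
  have h3 : (z * (w i * conj (w j))).im
      = Complex.normSq z * (w j * conj (w i)).im
        + (z * conj (z + 1) * (w i * conj (w j))).im := by
    simp [Complex.normSq_apply]; ring
  rw [h3]
  have := Complex.normSq_nonneg z
  positivity

/-- Nonzero nonnegative combinations do not vanish. -/
lemma GoodSeq.comb_ne {z : ℂ} (hz : 0 < z.im) {n : ℕ} {w : ℕ → ℂ} (hw : GoodSeq z n w)
    (c : ℕ → ℝ) (s : Finset ℕ) (hs : ∀ i ∈ s, i ≤ n) (hc : ∀ i, 0 ≤ c i)
    (hpos : ∃ i ∈ s, 0 < c i) : ∑ i ∈ s, (c i : ℂ) * w i ≠ 0 := by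
  intro h0
  have h : 0 < ((z + 1) * ((∑ i ∈ s, (c i : ℂ) * w i) * conj (w 0))).im := by
    rw [Finset.sum_mul, Finset.mul_sum, Complex.im_sum]
    have e : ∀ i, ((z + 1) * ((c i : ℂ) * w i * conj (w 0))).im
        = c i * ((z + 1) * (w i * conj (w 0))).im := fun i => by
      rw [← Complex.im_ofReal_mul]; congr 1; ring
    refine Finset.sum_pos' (fun i hi => ?_) ?_
    · rw [e]; exact mul_nonneg (hc i) (hw.Cpos hz i (hs i hi)).le
    · obtain ⟨i, hi, hci⟩ := hpos
      refine ⟨i, hi, ?_⟩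
      rw [e]; exact mul_pos hci (hw.Cpos hz i (hs i hi))
  rw [h0] at h
  simp at h

lemma GoodSeq.sum_ne {z : ℂ} (hz : 0 < z.im) {n : ℕ} {w : ℕ → ℂ} (hw : GoodSeq z n w)
    (s : Finset ℕ) (hs : ∀ i ∈ s, i ≤ n) (hne : s.Nonempty) : ∑ i ∈ s, w i ≠ 0 := by
  have := hw.comb_ne hz (fun _ => 1) s hs (fun _ => zero_le_one)
    (by obtain ⟨i, hi⟩ := hne; exact ⟨i, hi, one_pos⟩)
  simpa using this

lemma GoodSeq.step {z : ℂ} (hz : 0 < z.im) {n : ℕ} {w w' : ℕ → ℂ} (hw : GoodSeq z n w)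
    (h : ∀ k ≤ n + 1, w' k = z * ∑ j ∈ Finset.range (n + 1), w j
      + ∑ j ∈ Finset.Ico k (n + 1), w j) : GoodSeq z (n + 1) w' := by
  have split : ∀ k l, k ≤ l → l ≤ n + 1 → ∃ s1 s s2 : ℂ,
      s1 = ∑ j ∈ Finset.Ico 0 k, w j ∧ s = ∑ j ∈ Finset.Ico k l, w j ∧
      s2 = ∑ j ∈ Finset.Ico l (n + 1), w j ∧
      w' k = z * s1 + (z + 1) * (s + s2) ∧ w' l = z * (s1 + s) + (z + 1) * s2 := by
    intro k l hkl hl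
    refine ⟨_, _, _, rfl, rfl, rfl, ?_, ?_⟩
    · rw [h k (hkl.trans hl), Finset.range_eq_Ico,
        ← Finset.sum_Ico_consecutive w (Nat.zero_le k) (hkl.trans hl),
        ← Finset.sum_Ico_consecutive w hkl hl]
      ring
    · rw [h l hl, Finset.range_eq_Ico,
        ← Finset.sum_Ico_consecutive w (Nat.zero_le k) (hkl.trans hl),
        ← Finset.sum_Ico_consecutive w hkl hl]
      ring
  have A1 : ∀ k l, k ≤ l → l ≤ n + 1 →
      z.im * Complex.normSq (∑ j ∈ Finset.Ico k l, w j) ≤ (w' l * conj (w' k)).im := by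
    intro k l hkl hl
    obtain ⟨s1, s, s2, h1, hs, h2, e1, e2⟩ := split k l hkl hl
    have p1 : 0 ≤ (z * (s1 * conj s)).im := by
      rw [h1, hs]
      refine im_sum_mul z w _ _ fun i hi j hj => hw.D i j ?_ ?_ <;>
        simp only [Finset.mem_Ico] at hi hj <;> omega
    have p2 : 0 ≤ ((z + 1) * (s2 * conj s)).im := by
      rw [h2, hs]
      refine im_sum_mul (z + 1) w _ _ fun i hi j hj => hw.C j i ?_ ?_ <;>
        simp only [Finset.mem_Ico] at hi hj <;> omega
    rw [← hs]
    have : (w' l * conj (w' k)).im = z.im * Complex.normSq s + (z * (s1 * conj s)).im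
        + ((z + 1) * (s2 * conj s)).im := by
      rw [e1, e2]; simp [Complex.normSq_apply]; ring
    linarith
  have ne0 : w' 0 ≠ 0 := by
    have e : w' 0 = (z + 1) * ∑ j ∈ Finset.range (n + 1), w j := by
      rw [h 0 (Nat.zero_le _), Finset.range_eq_Ico]; ring
    rw [e]
    refine mul_ne_zero ?_ (hw.sum_ne hz _ (fun i hi => ?_) ⟨0, by simp⟩)
    · intro h
      have := congrArg Complex.im h
      simp at this; linarith
    · simp at hi; omega
  refine ⟨fun k hk => ?_, fun k l hkl hl => ?_, fun k l hkl hl => ?_⟩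
  · rcases Nat.eq_zero_or_pos k with rfl | hk0
    · exact ne0
    · intro h0
      have a := A1 0 k (Nat.zero_le _) hk
      rw [h0] at a
      have b := hw.sum_ne hz (Finset.Ico 0 k) (fun i hi => by simp at hi; omega)
        ⟨0, by simpa using hk0⟩
      have := mul_pos hz (Complex.normSq_pos.2 b)
      simp at a this
      linarith
  · refine le_trans ?_ (A1 k l hkl hl)
    have := Complex.normSq_nonneg (∑ j ∈ Finset.Ico k l, w j)
    positivity
  · obtain ⟨s1, s, s2, h1, hs, h2, e1, e2⟩ := split k l hkl hl
    have p1 : 0 ≤ ((z + 1) * (s * conj s1)).im := by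
      rw [h1, hs]
      refine im_sum_mul (z + 1) w _ _ fun i hi j hj => hw.C j i ?_ ?_ <;>
        simp only [Finset.mem_Ico] at hi hj <;> omega
    have p2 : 0 ≤ (z * (s * conj s2)).im := by
      rw [h2, hs]
      refine im_sum_mul z w _ _ fun i hi j hj => hw.D i j ?_ ?_ <;>
        simp only [Finset.mem_Ico] at hi hj <;> omega
    have : (z * conj (z + 1) * (w' k * conj (w' l))).im
        = z.im * Complex.normSq (z * s1 + (z + 1) * s2)
          + Complex.normSq z * ((z + 1) * (s * conj s1)).im
          + Complex.normSq (z + 1) * (z * (s * conj s2)).im := by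
      rw [e1, e2]; simp [Complex.normSq_apply]; ring
    rw [this]
    have := Complex.normSq_nonneg (z * s1 + (z + 1) * s2)
    have := Complex.normSq_nonneg z
    have := Complex.normSq_nonneg (z + 1)
    positivity

lemma norm_conj_sub_le (z a : ℂ) (hz : 0 < z.im) (ha : a.im ≤ 0) : ‖conj z - a‖ ≤ ‖z - a‖ := by
  rw [← sq_le_sq₀ (norm_nonneg _) (norm_nonneg _), ← Complex.normSq_eq_norm_sq,
    ← Complex.normSq_eq_norm_sq]
  simp [Complex.normSq_apply]
  nlinarith

lemma norm_eval_conj_le (p : ℂ[X]) (hp : ∀ z : ℂ, 0 < z.im → p.eval z ≠ 0) (z : ℂ)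
    (hz : 0 < z.im) : ‖p.eval (conj z)‖ ≤ ‖p.eval z‖ := by
  have hs := IsAlgClosed.splits p
  have key : ∀ y : ℂ, ‖p.eval y‖ = ‖p.leadingCoeff‖ * (p.roots.map fun a => ‖y - a‖).prod := by
    intro y
    conv_lhs => rw [hs.eq_prod_roots]
    rw [eval_mul, eval_C, norm_mul, eval_multiset_prod, Multiset.map_map]
    congr 1
    have : ∀ m : Multiset ℂ, ‖m.prod‖ = (m.map norm).prod := fun m =>
      map_multiset_prod (normHom : ℂ →*₀ ℝ) m
    rw [this, Multiset.map_map]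
    congr 1
    refine Multiset.map_congr rfl fun a _ => ?_
    simp
  rw [key, key]
  refine mul_le_mul_of_nonneg_left ?_ (norm_nonneg _)
  refine Multiset.prod_map_le_prod_map₀ _ _ (fun a _ => norm_nonneg _) fun a ha => ?_
  refine norm_conj_sub_le z a hz ?_
  by_contra hcon
  push Not at hcon
  exact hp a hcon (isRoot_of_mem_roots ha)

lemma eval_toC_conj (p : ℝ[X]) (z : ℂ) : (toC p).eval (conj z) = conj ((toC p).eval z) := by
  unfold toC
  rw [eval_map_algebraMap, eval_map_algebraMap]
  exact Polynomial.aeval_conj p z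

lemma interlaces_im {f g : ℝ[X]} (hf : f ≠ 0) (h : Interlaces f g) (z : ℂ) (hz : 0 < z.im) :
    0 ≤ ((toC g).eval z * conj ((toC f).eval z)).im := by
  rcases h with h | h
  · exfalso
    apply hf
    ext n
    have := congrArg (fun p => (p.coeff n).im) h
    simpa [toC] using this
  · have := norm_eval_conj_le _ h z hz
    simp only [eval_add, eval_mul, eval_C, eval_toC_conj] at this
    rw [← sq_le_sq₀ (norm_nonneg _) (norm_nonneg _), ← Complex.normSq_eq_norm_sq,
      ← Complex.normSq_eq_norm_sq] at this
    simp [Complex.normSq_apply] at this ⊢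
    nlinarith

lemma interlaces_of_im {f g : ℝ[X]} (hf : ∀ z : ℂ, 0 < z.im → (toC f).eval z ≠ 0)
    (h : ∀ z : ℂ, 0 < z.im → 0 ≤ ((toC g).eval z * conj ((toC f).eval z)).im) :
    Interlaces f g := by
  right
  intro z hz h0
  have h1 := h z hz
  have h2 := Complex.normSq_pos.2 (hf z hz)
  simp only [eval_add, eval_mul, eval_C] at h0
  rw [eq_neg_of_add_eq_zero_left h0] at h1
  simp [Complex.normSq_apply] at h1 h2
  nlinarith

open Filter Topology

lemma arg_contOn {a : ℂ → ℂ} {U : Set ℂ} (ha : ContinuousOn a U) (hne : ∀ z ∈ U, a z ≠ 0)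
    (him : ∀ z ∈ U, 0 ≤ (a z).im) : ContinuousOn (fun z => (a z).arg) U := by
  have h : ContinuousOn Complex.arg {w : ℂ | 0 ≤ w.im ∧ w ≠ 0} := by
    rintro w ⟨hw, hw0⟩
    by_cases hs : w ∈ Complex.slitPlane
    · exact (Complex.continuousAt_arg hs).continuousWithinAt
    · rw [Complex.mem_slitPlane_iff] at hs
      push Not at hs
      have hre : w.re < 0 := lt_of_le_of_ne hs.1 fun h => hw0 (Complex.ext h hs.2)
      exact (Complex.continuousWithinAt_arg_of_re_neg_of_im_zero hre hs.2).mono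
        fun x hx => hx.1
  exact h.comp ha fun z hz => ⟨him z hz, hne z hz⟩

lemma im_div_nonneg {a b : ℂ} (h : 0 ≤ (a * conj b).im) : 0 ≤ (a / b).im := by
  have e : a / b = ((Complex.normSq b)⁻¹ : ℝ) * (a * conj b) := by
    rw [div_eq_mul_inv, Complex.inv_def]; ring
  rw [e, Complex.im_ofReal_mul]
  exact mul_nonneg (inv_nonneg.2 (Complex.normSq_nonneg _)) h

lemma analytic_core (F G H e : ℂ → ℂ) (d : ℕ)
    (cF : Continuous F) (cG : Continuous G) (cH : Continuous H) (ce : Continuous e)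
    (nF : ∀ z : ℂ, 0 < z.im → F z ≠ 0) (nG : ∀ z : ℂ, 0 < z.im → G z ≠ 0)
    (nH : ∀ z : ℂ, 0 < z.im → H z ≠ 0) (ne : ∀ z : ℂ, 0 < z.im → e z ≠ 0)
    (i1 : ∀ z : ℂ, 0 < z.im → 0 ≤ (F z * conj (e z)).im)
    (i2 : ∀ z : ℂ, 0 < z.im → 0 ≤ (G z * conj (F z)).im)
    (i3 : ∀ z : ℂ, 0 < z.im → 0 ≤ (H z * conj (G z)).im)
    (i4 : ∀ z : ℂ, 0 < z.im → 0 ≤ (z * e z * conj ((z + 1) * H z)).im)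
    (LF LG LH Le : ℝ) (pF : 0 < LF) (pG : 0 < LG) (pH : 0 < LH) (pe : 0 < Le)
    (tF : Tendsto (fun y : ℝ => F (y * Complex.I) / (y * Complex.I) ^ d) atTop (𝓝 (LF : ℂ)))
    (tG : Tendsto (fun y : ℝ => G (y * Complex.I) / (y * Complex.I) ^ d) atTop (𝓝 (LG : ℂ)))
    (tH : Tendsto (fun y : ℝ => H (y * Complex.I) / (y * Complex.I) ^ d) atTop (𝓝 (LH : ℂ)))
    (te : Tendsto (fun y : ℝ => e (y * Complex.I) / (y * Complex.I) ^ d) atTop (𝓝 (Le : ℂ)))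
    (z : ℂ) (hz : 0 < z.im) : 0 ≤ (H z * conj (F z)).im := by
  set U : Set ℂ := {z | 0 < z.im} with hU
  have n1 : ∀ z : ℂ, 0 < z.im → z + 1 ≠ 0 := by
    intro z hz h
    have := congrArg Complex.im h
    simp at this; linarith
  have n0 : ∀ z : ℂ, 0 < z.im → z ≠ 0 := by
    rintro z hz rfl
    simp at hz
  -- ratio limits
  have tq : ∀ (P Q : ℂ → ℂ) (LP LQ : ℝ), 0 < LP → 0 < LQ →
      Tendsto (fun y : ℝ => P (y * Complex.I) / (y * Complex.I) ^ d) atTop (𝓝 (LP : ℂ)) →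
      Tendsto (fun y : ℝ => Q (y * Complex.I) / (y * Complex.I) ^ d) atTop (𝓝 (LQ : ℂ)) →
      Tendsto (fun y : ℝ => P (y * Complex.I) / Q (y * Complex.I)) atTop (𝓝 ((LP / LQ : ℝ) : ℂ)) := by
    intro P Q LP LQ hP hQ h1 h2
    have := h1.div h2 (by exact_mod_cast hQ.ne')
    rw [Complex.ofReal_div]
    refine this.congr' ?_
    filter_upwards [eventually_gt_atTop 0] with y hy
    have : ((y : ℂ) * Complex.I) ^ d ≠ 0 := by
      apply pow_ne_zero; simp [hy.ne']
    simp only [Pi.div_apply]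
    rw [div_div_div_cancel_right₀ this]
  have targ : ∀ (a : ℝ → ℂ) (L : ℝ), 0 < L → Tendsto a atTop (𝓝 (L : ℂ)) →
      Tendsto (fun y => (a y).arg) atTop (𝓝 0) := by
    intro a L hL h
    have h2 : ContinuousAt Complex.arg (L : ℂ) :=
      Complex.continuousAt_arg (Complex.ofReal_mem_slitPlane.2 hL)
    have := h2.tendsto.comp h
    rwa [Complex.arg_ofReal_of_nonneg hL.le] at this
  have t5 : Tendsto (fun y : ℝ => (y * Complex.I) / (y * Complex.I + 1)) atTop (𝓝 ((1 : ℝ) : ℂ)) := by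
    have h1 : Tendsto (fun y : ℝ => ((y : ℂ) * Complex.I)⁻¹) atTop (𝓝 0) := by
      have := (Complex.continuous_ofReal.tendsto 0).comp tendsto_inv_atTop_zero
      have := this.mul_const (Complex.I⁻¹)
      simpa [Function.comp_def, mul_inv, mul_comm] using this
    have h2 : Tendsto (fun y : ℝ => (1 + ((y : ℂ) * Complex.I)⁻¹)⁻¹) atTop (𝓝 ((1 : ℝ) : ℂ)) := by
      have := (h1.const_add 1).inv₀ (by simp)
      simpa using this
    refine h2.congr' ?_
    filter_upwards [eventually_gt_atTop 0] with y hy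
    have h3 : ((y : ℂ) * Complex.I) ≠ 0 := by simp [hy.ne']
    have h4 : ((y : ℂ) * Complex.I) + 1 ≠ 0 := n1 _ (by simpa using hy)
    have h5 : 1 + ((y : ℂ) * Complex.I)⁻¹ = (y * Complex.I + 1) / (y * Complex.I) := by
      rw [add_div, div_self h3, one_div]
    rw [h5, inv_div]
  set a1 : ℂ → ℂ := fun z => F z / e z with ha1
  set a2 : ℂ → ℂ := fun z => G z / F z with ha2
  set a3 : ℂ → ℂ := fun z => H z / G z with ha3
  set a5 : ℂ → ℂ := fun z => z / (z + 1) with ha5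
  set a4 : ℂ → ℂ := fun z => z * e z / ((z + 1) * H z) with ha4
  have m1 : ∀ z ∈ U, 0 ≤ (a1 z).im := fun z hz => im_div_nonneg (i1 z hz)
  have m2 : ∀ z ∈ U, 0 ≤ (a2 z).im := fun z hz => im_div_nonneg (i2 z hz)
  have m3 : ∀ z ∈ U, 0 ≤ (a3 z).im := fun z hz => im_div_nonneg (i3 z hz)
  have m4 : ∀ z ∈ U, 0 ≤ (a4 z).im := fun z hz => im_div_nonneg (i4 z hz)
  have m5 : ∀ z ∈ U, 0 < (a5 z).im := fun z hz => by
    have hp := Complex.normSq_pos.2 (n1 z hz)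
    have : (a5 z).im = z.im / Complex.normSq (z + 1) := by
      simp only [ha5, Complex.div_im]
      simp
      field_simp
      ring
    rw [this]
    exact div_pos hz hp
  have z1 : ∀ z ∈ U, a1 z ≠ 0 := fun z hz => div_ne_zero (nF z hz) (ne z hz)
  have z2 : ∀ z ∈ U, a2 z ≠ 0 := fun z hz => div_ne_zero (nG z hz) (nF z hz)
  have z3 : ∀ z ∈ U, a3 z ≠ 0 := fun z hz => div_ne_zero (nH z hz) (nG z hz)
  have z4 : ∀ z ∈ U, a4 z ≠ 0 := fun z hz => div_ne_zero
    (mul_ne_zero (n0 z hz) (ne z hz)) (mul_ne_zero (n1 z hz) (nH z hz))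
  have z5 : ∀ z ∈ U, a5 z ≠ 0 := fun z hz => div_ne_zero (n0 z hz) (n1 z hz)
  have c1 := arg_contOn (cF.continuousOn.div ce.continuousOn ne : ContinuousOn a1 U) z1 m1
  have c2 := arg_contOn (cG.continuousOn.div cF.continuousOn nF : ContinuousOn a2 U) z2 m2
  have c3 := arg_contOn (cH.continuousOn.div cG.continuousOn nG : ContinuousOn a3 U) z3 m3
  have c4 := arg_contOn ((continuous_id.mul ce).continuousOn.div
    ((continuous_id.add continuous_const).mul cH).continuousOn
    (fun z hz => mul_ne_zero (n1 z hz) (nH z hz)) : ContinuousOn a4 U) z4 m4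
  have c5 := arg_contOn (continuous_id.continuousOn.div
    (continuous_id.add continuous_const).continuousOn n1 : ContinuousOn a5 U) z5
    (fun z hz => (m5 z hz).le)
  set Φ : ℂ → ℝ := fun z => (a1 z).arg + (a2 z).arg + (a3 z).arg + (a4 z).arg - (a5 z).arg with hΦ
  have cΦ : ContinuousOn Φ U := (((c1.add c2).add c3).add c4).sub c5
  have cosΦ : ∀ z ∈ U, Real.cos (Φ z) = 1 := by
    intro z hz
    have hprod : a1 z * a2 z * a3 z * a4 z = a5 z := by
      have := nF z hz; have := nG z hz; have := nH z hz; have := ne z hz; have := n1 z hz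
      simp only [ha1, ha2, ha3, ha4, ha5]
      field_simp
    have : ((Φ z : ℝ) : Real.Angle) = 0 := by
      simp only [hΦ, Real.Angle.coe_sub, Real.Angle.coe_add]
      rw [← hprod, Complex.arg_mul_coe_angle (mul_ne_zero (mul_ne_zero (z1 z hz) (z2 z hz)) (z3 z hz)) (z4 z hz),
        Complex.arg_mul_coe_angle (mul_ne_zero (z1 z hz) (z2 z hz)) (z3 z hz),
        Complex.arg_mul_coe_angle (z1 z hz) (z2 z hz), sub_self]
    rw [← Real.Angle.cos_coe, this, Real.Angle.cos_zero]
  have tΦ : Tendsto (fun y : ℝ => Φ (y * Complex.I)) atTop (𝓝 0) := by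
    have l1 := targ _ _ (div_pos pF pe) (tq F e LF Le pF pe tF te)
    have l2 := targ _ _ (div_pos pG pF) (tq G F LG LF pG pF tG tF)
    have l3 := targ _ _ (div_pos pH pG) (tq H G LH LG pH pG tH tG)
    have l5 := targ _ _ one_pos t5
    have l4 := targ _ _ (mul_pos one_pos (div_pos pe pH)) (by
      rw [Complex.ofReal_mul]
      exact t5.mul (tq e H Le LH pe pH te tH))
    have := (((l1.add l2).add l3).add l4).sub l5
    simp only [add_zero, sub_zero] at this
    refine this.congr fun y => ?_
    simp only [hΦ, ha1, ha2, ha3, ha4, ha5, div_mul_div_comm]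
  have hle : ∀ z ∈ U, Φ z ≤ 0 := by
    intro z hz
    by_contra hcon
    push Not at hcon
    set c := min (Φ z) Real.pi with hc
    have hc0 : 0 < c := lt_min hcon Real.pi_pos
    obtain ⟨y, hy1, hy2⟩ := ((tΦ.eventually (gt_mem_nhds hc0)).and (eventually_gt_atTop 0)).exists
    have hconn : IsPreconnected U := (convex_halfSpace_im_gt 0).isPreconnected
    have hmem : c ∈ Set.Icc (Φ (y * Complex.I)) (Φ z) := ⟨hy1.le, min_le_left _ _⟩
    obtain ⟨x, hx, hxc⟩ := hconn.intermediate_value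
      (show (y * Complex.I : ℂ) ∈ U by simpa [hU] using hy2) hz cΦ hmem
    have h1 := cosΦ x hx
    rw [hxc] at h1
    have hpi := Real.pi_pos
    have hcpi : c ≤ Real.pi := min_le_right _ _
    have h2 := (Real.cos_eq_one_iff_of_lt_of_lt (by linarith) (by linarith)).1 h1
    linarith
  have hfin := hle z hz
  have g1 := Complex.arg_nonneg_iff.2 (m1 z hz)
  have g2 := Complex.arg_nonneg_iff.2 (m2 z hz)
  have g3 := Complex.arg_nonneg_iff.2 (m3 z hz)
  have g4 := Complex.arg_nonneg_iff.2 (m4 z hz)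
  have g5 := Complex.arg_le_pi (a5 z)
  have hsum : (a2 z).arg + (a3 z).arg ≤ Real.pi := by
    simp only [hΦ] at hfin; linarith
  have hargs : 0 ≤ (a2 z * a3 z).im := by
    rw [← Complex.norm_mul_exp_arg_mul_I (a2 z), ← Complex.norm_mul_exp_arg_mul_I (a3 z)]
    have : (‖a2 z‖ : ℂ) * Complex.exp ((a2 z).arg * Complex.I) *
        ((‖a3 z‖ : ℂ) * Complex.exp ((a3 z).arg * Complex.I))
        = ((‖a2 z‖ * ‖a3 z‖ : ℝ) : ℂ) * Complex.exp ((((a2 z).arg + (a3 z).arg : ℝ) : ℂ) * Complex.I) := by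
      push_cast
      rw [add_mul, Complex.exp_add]; ring
    rw [this, Complex.im_ofReal_mul, Complex.exp_ofReal_mul_I_im]
    exact mul_nonneg (by positivity) (Real.sin_nonneg_of_nonneg_of_le_pi (by linarith) hsum)
  have hHF : H z * conj (F z) = (Complex.normSq (F z) : ℂ) * (a2 z * a3 z) := by
    have := nF z hz; have := nG z hz
    rw [← Complex.mul_conj]
    simp only [ha2, ha3]
    field_simp
  rw [hHF, Complex.im_ofReal_mul]
  exact mul_nonneg (Complex.normSq_nonneg _) hargs

noncomputable def DD (q : ℝ[X]) : ℝ[X] := q.comp (X + 1) - q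

lemma DD_add (p q : ℝ[X]) : DD (p + q) = DD p + DD q := by
  simp only [DD, add_comp]; ring

lemma DD_iter_add (k : ℕ) (p q : ℝ[X]) : DD^[k] (p + q) = DD^[k] p + DD^[k] q := by
  induction k with
  | zero => rfl
  | succ k ih => rw [Function.iterate_succ_apply', ih, DD_add, ← Function.iterate_succ_apply' DD,
      ← Function.iterate_succ_apply' DD]

lemma DD_X_mul (q : ℝ[X]) : DD (X * q) = (X + 1) * DD q + q := by
  simp only [DD, mul_comp, X_comp]; ring

lemma DD_iter_X_mul (k : ℕ) (p : ℝ[X]) : DD^[k + 1] (X * p)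
    = X * DD^[k + 1] p + C ((k : ℝ) + 1) * (DD^[k + 1] p + DD^[k] p) := by
  induction k with
  | zero => simp [DD_X_mul]; ring
  | succ k ih =>
    have hC : ∀ (c : ℝ) (q : ℝ[X]), DD (C c * q) = C c * DD q := fun c q => by
      simp only [DD, mul_comp, C_comp]; ring
    rw [Function.iterate_succ_apply', ih, DD_add, DD_X_mul, hC, DD_add,
      ← Function.iterate_succ_apply' DD k p, ← Function.iterate_succ_apply' DD (k + 1) p]
    push_cast
    simp only [C_add, C_1]
    ring

lemma natDegree_DD (p : ℝ[X]) (hp : p.natDegree ≠ 0) : (DD p).natDegree < p.natDegree := by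
  have h1 : (X + 1 : ℝ[X]) = X + C 1 := by simp
  have e1 : (p.comp (X + 1)).natDegree = p.natDegree := by
    rw [natDegree_comp, h1, natDegree_X_add_C, mul_one]
  have p0 : p ≠ 0 := by rintro rfl; simp at hp
  have l1 : (p.comp (X + 1)).leadingCoeff = p.leadingCoeff := by
    rw [leadingCoeff_comp (by rw [h1, natDegree_X_add_C]; exact one_ne_zero), h1, leadingCoeff_X_add_C]
    simp
  have c0 : p.comp (X + 1) ≠ 0 := by
    intro h; rw [h, leadingCoeff_zero] at l1; exact p0 (leadingCoeff_eq_zero.1 l1.symm)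
  have hd : (p.comp (X + 1)).degree = p.degree := by
    rw [degree_eq_natDegree c0, degree_eq_natDegree p0, e1]
  have hlt := degree_sub_lt_left hd c0 l1
  by_cases h0 : DD p = 0
  · rw [h0, natDegree_zero]; omega
  · rw [← e1]; exact natDegree_lt_natDegree h0 hlt

lemma DD_iter_zero (k : ℕ) : ∀ p : ℝ[X], p.natDegree < k → DD^[k] p = 0 := by
  have hz : ∀ k, DD^[k] (0 : ℝ[X]) = 0 := fun k =>
    Function.iterate_fixed (by simp [DD]) k
  induction k with
  | zero => intro p h; omega
  | succ k ih =>
    intro p h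
    rw [Function.iterate_succ_apply]
    by_cases hp : p.natDegree = 0
    · rw [natDegree_eq_zero] at hp
      obtain ⟨c, rfl⟩ := hp
      have : DD (C c) = 0 := by simp [DD]
      rw [this, hz]
    · exact ih _ (by have := natDegree_DD p hp; omega)

lemma coeff_subdivE (p : ℝ[X]) (k : ℕ) : (subdivE p).coeff k = (DD^[k] p).eval 0 := by
  have : subdivE p = ∑ k ∈ Finset.range (p.natDegree + 1), C ((DD^[k] p).eval 0) * X ^ k := rfl
  rw [this, finsetSum_coeff]
  simp only [coeff_C_mul_X_pow]
  rw [Finset.sum_ite_eq]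
  split_ifs with h
  · rfl
  · rw [DD_iter_zero k p (by simpa using h)]; simp

lemma subdivE_add (p q : ℝ[X]) : subdivE (p + q) = subdivE p + subdivE q := by
  ext k; simp [coeff_subdivE, DD_iter_add]

lemma subdivE_X_mul (p : ℝ[X]) :
    subdivE (X * p) = X * derivative ((X + 1) * subdivE p) := by
  ext k
  cases k with
  | zero => simp [coeff_subdivE]
  | succ k =>
    rw [coeff_subdivE, DD_iter_X_mul, coeff_X_mul, coeff_derivative, add_mul, one_mul,
      coeff_add, coeff_X_mul, coeff_subdivE, coeff_subdivE]
    simp; ring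

lemma subdivE_X_add_one_mul (p : ℝ[X]) :
    subdivE ((X + 1) * p) = (X + 1) * derivative (X * subdivE p) := by
  rw [add_mul, one_mul, subdivE_add, subdivE_X_mul]
  simp only [derivative_mul, derivative_add, derivative_X, derivative_one]; ring

lemma Ekd_diff (n k : ℕ) (hk : k ≤ n) : Ekd (n + 1) k = Ekd (n + 1) (k + 1) + Ekd n k := by
  unfold Ekd
  rw [← subdivE_add]
  congr 1
  rw [show n + 1 - k = (n - k) + 1 by omega, show n + 1 - (k + 1) = n - k by omega]
  ring

lemma Ekd_ends (n : ℕ) : X * Ekd (n + 1) 0 = (X + 1) * Ekd (n + 1) (n + 1) := by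
  have r0 : ∀ m, Ekd (m + 1) 0 = (X + 1) * derivative (X * Ekd m 0) := fun m => by
    unfold Ekd
    rw [← subdivE_X_add_one_mul]
    congr 1
    simp only [Nat.sub_zero]; ring
  have r1 : ∀ m, Ekd (m + 1) (m + 1) = X * derivative ((X + 1) * Ekd m m) := fun m => by
    unfold Ekd
    rw [← subdivE_X_mul]
    congr 1
    simp only [Nat.sub_self]; ring
  induction n with
  | zero =>
    rw [r0, r1]
    have : Ekd 0 0 = 1 := by simp [Ekd, subdivE]
    rw [this]; simp; ring
  | succ n ih => rw [r0, r1 (n + 1), ← ih]; ring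

lemma Ekd_rec (n k : ℕ) (hk : k ≤ n + 1) : Ekd (n + 1) k
    = X * ∑ j ∈ Finset.range (n + 1), Ekd n j + ∑ j ∈ Finset.Ico k (n + 1), Ekd n j := by
  have tele : ∀ m, m ≤ n + 1 → Ekd (n + 1) (n + 1 - m)
      = Ekd (n + 1) (n + 1) + ∑ j ∈ Finset.Ico (n + 1 - m) (n + 1), Ekd n j := by
    intro m
    induction m with
    | zero => intro _; simp
    | succ m ih =>
      intro hm
      rw [Ekd_diff n _ (by omega), show n + 1 - (m + 1) + 1 = n + 1 - m by omega, ih (by omega),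
        Finset.sum_eq_sum_Ico_succ_bot (show n + 1 - (m + 1) < n + 1 by omega),
        show n + 1 - (m + 1) + 1 = n + 1 - m by omega]
      ring
  have h0 := tele (n + 1) le_rfl
  rw [Nat.sub_self, ← Finset.range_eq_Ico] at h0
  have he := Ekd_ends n
  rw [h0] at he
  have h1 : Ekd (n + 1) (n + 1) = X * ∑ j ∈ Finset.range (n + 1), Ekd n j := by
    linear_combination -he
  have := tele (n + 1 - k) (by omega)
  rw [show n + 1 - (n + 1 - k) = k by omega] at this
  rw [this, h1]

lemma Ekd_zero : Ekd 0 0 = 1 := by simp [Ekd, subdivE]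

lemma toC_eval_rec (z : ℂ) (n k : ℕ) (hk : k ≤ n + 1) : (toC (Ekd (n + 1) k)).eval z
    = z * ∑ j ∈ Finset.range (n + 1), (toC (Ekd n j)).eval z
      + ∑ j ∈ Finset.Ico k (n + 1), (toC (Ekd n j)).eval z := by
  rw [Ekd_rec n k hk]
  simp [toC, Polynomial.map_sum, eval_finsetSum]

lemma good_Ekd (z : ℂ) (hz : 0 < z.im) (n : ℕ) :
    GoodSeq z n (fun k => (toC (Ekd n k)).eval z) := by
  induction n with
  | zero =>
    have h : ∀ j, j ≤ 0 → (toC (Ekd 0 j)).eval z = 1 := fun j hj => by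
      obtain rfl : j = 0 := by omega
      simp [Ekd_zero, toC]
    refine ⟨fun j hj => ?_, fun i j hij hj => ?_, fun i j hij hj => ?_⟩
    · simp only [h j hj]; exact one_ne_zero
    · simp only [h j hj, h i (hij.trans hj)]; simp
    · simp only [h j hj, h i (hij.trans hj)]; simp; linarith
  | succ n ih => exact ih.step hz fun k hk => toC_eval_rec z n k hk

lemma tendsto_Ekd (n : ℕ) : ∃ L : ℕ → ℝ, ∀ k ≤ n, 0 < L k ∧
    Tendsto (fun y : ℝ => (toC (Ekd n k)).eval (y * Complex.I) / (y * Complex.I) ^ n)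
      atTop (𝓝 (L k : ℂ)) := by
  have hinv : Tendsto (fun y : ℝ => ((y : ℂ) * Complex.I)⁻¹) atTop (𝓝 0) := by
    have := (Complex.continuous_ofReal.tendsto 0).comp tendsto_inv_atTop_zero
    have := this.mul_const (Complex.I⁻¹)
    simpa [Function.comp_def, mul_inv, mul_comm] using this
  induction n with
  | zero =>
    refine ⟨fun _ => 1, fun k hk => ⟨one_pos, ?_⟩⟩
    obtain rfl : k = 0 := by omega
    simp [Ekd_zero, toC]
  | succ n ih =>
    obtain ⟨L, hL⟩ := ih
    refine ⟨fun _ => ∑ j ∈ Finset.range (n + 1), L j, fun k hk => ⟨?_, ?_⟩⟩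
    · exact Finset.sum_pos (fun j hj => (hL j (by simp at hj; omega)).1) ⟨0, by simp⟩
    · have t1 := tendsto_finsetSum (Finset.range (n + 1)) fun j hj =>
        (hL j (by simp at hj; omega)).2
      have t2 := tendsto_finsetSum (Finset.Ico k (n + 1)) fun j hj =>
        (hL j (by simp at hj; omega)).2
      have t3 := t1.add (hinv.mul t2)
      rw [zero_mul, add_zero] at t3
      rw [Complex.ofReal_sum]
      refine t3.congr' ?_
      filter_upwards [eventually_gt_atTop 0] with y hy
      have hy0 : (y : ℂ) * Complex.I ≠ 0 := by simp [hy.ne']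
      rw [toC_eval_rec _ n k hk, ← Finset.sum_div, ← Finset.sum_div]
      generalize (y : ℂ) * Complex.I = z at *
      field_simp
      ring

lemma cone_facts {d : ℕ} {f : ℝ[X]} (hf : f ∈ coneE d) (hf0 : f ≠ 0) :
    (∀ z : ℂ, 0 < z.im → (toC f).eval z ≠ 0) ∧
    (∀ z : ℂ, 0 < z.im → 0 ≤ ((toC f).eval z * conj ((toC (Ekd d 0)).eval z)).im) ∧
    (∀ z : ℂ, 0 < z.im →
      0 ≤ (z * (toC (Ekd d 0)).eval z * conj ((z + 1) * (toC f).eval z)).im) ∧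
    ∃ L : ℝ, 0 < L ∧ Tendsto (fun y : ℝ => (toC f).eval (y * Complex.I) / (y * Complex.I) ^ d)
      atTop (𝓝 (L : ℂ)) := by
  obtain ⟨c, hc, rfl⟩ := hf
  have hpos : ∃ i ∈ Finset.range (d + 1), 0 < c i := by
    by_contra hcon
    push Not at hcon
    apply hf0
    refine Finset.sum_eq_zero fun i hi => ?_
    rw [le_antisymm (hcon i hi) (hc i), zero_smul]
  have hev : ∀ z : ℂ, (toC (∑ i ∈ Finset.range (d + 1), c i • Ekd d i)).eval z
      = ∑ i ∈ Finset.range (d + 1), (c i : ℂ) * (toC (Ekd d i)).eval z := by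
    intro z
    simp [toC, Polynomial.map_sum, eval_finsetSum, Polynomial.smul_eq_C_mul]
  refine ⟨fun z hz => ?_, fun z hz => ?_, fun z hz => ?_, ?_⟩
  · rw [hev]
    exact (good_Ekd z hz d).comb_ne hz c _ (fun i hi => by simp at hi; omega) hc hpos
  · rw [hev, Finset.sum_mul, Complex.im_sum]
    refine Finset.sum_nonneg fun i hi => ?_
    rw [mul_assoc, Complex.im_ofReal_mul]
    exact mul_nonneg (hc i) ((good_Ekd z hz d).A 0 i (Nat.zero_le _) (by simp at hi; omega))
  · rw [hev, map_mul, map_sum, Finset.mul_sum, Finset.mul_sum, Complex.im_sum]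
    refine Finset.sum_nonneg fun i hi => ?_
    have := mul_nonneg (hc i)
      ((good_Ekd z hz d).B 0 i (Nat.zero_le _) (by simp at hi; omega))
    rw [← Complex.im_ofReal_mul] at this
    convert this using 2
    rw [map_mul, Complex.conj_ofReal]
    ring
  · obtain ⟨L, hL⟩ := tendsto_Ekd d
    refine ⟨∑ i ∈ Finset.range (d + 1), c i * L i, ?_, ?_⟩
    · refine Finset.sum_pos' (fun i hi => ?_) ?_
      · exact mul_nonneg (hc i) (hL i (by simp at hi; omega)).1.le
      · obtain ⟨i, hi, hci⟩ := hpos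
        exact ⟨i, hi, mul_pos hci (hL i (by simp at hi; omega)).1⟩
    · have t := tendsto_finsetSum (Finset.range (d + 1)) fun i hi =>
        ((hL i (by simp at hi; omega)).2.const_mul (c i : ℂ))
      rw [Complex.ofReal_sum]
      simp only [Complex.ofReal_mul]
      refine t.congr fun y => ?_
      rw [hev, Finset.sum_div]
      exact Finset.sum_congr rfl fun i _ => by rw [mul_div_assoc]

/-- the relation `≺` is transitive on nonzero elements of `𝓔_d`. -/
theorem stmt5 (d : ℕ) (f g h : ℝ[X])
    (hf : f ∈ coneE d) (hg : g ∈ coneE d) (hh : h ∈ coneE d)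
    (hf0 : f ≠ 0) (hg0 : g ≠ 0) (hh0 : h ≠ 0)
    (hfg : Interlaces f g) (hgh : Interlaces g h) :
    Interlaces f h := by
  obtain ⟨nf, af, -, Lf, pf, tf⟩ := cone_facts hf hf0
  obtain ⟨ng, -, -, Lg, pg, tg⟩ := cone_facts hg hg0
  obtain ⟨nh, -, bh, Lh, ph, th⟩ := cone_facts hh hh0
  obtain ⟨L, hL⟩ := tendsto_Ekd d
  refine interlaces_of_im nf fun z hz => ?_
  exact analytic_core (fun z => (toC f).eval z) (fun z => (toC g).eval z)
    (fun z => (toC h).eval z) (fun z => (toC (Ekd d 0)).eval z) d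
    (toC f).continuous (toC g).continuous (toC h).continuous (toC (Ekd d 0)).continuous
    nf ng nh (fun z hz => (good_Ekd z hz d).ne 0 (Nat.zero_le _)) af
    (fun z hz => interlaces_im hf0 hfg z hz) (fun z hz => interlaces_im hg0 hgh z hz) bh
    Lf Lg Lh (L 0) pf pg ph (hL 0 (Nat.zero_le _)).1 tf tg th (hL 0 (Nat.zero_le _)).2 z hz
end

section
/- Let p = Σ_{k=0}^d a_k·x^k·(x+1)^{d−k} where a_k ≥ 0 for all k, and let (ã, b̃) be the R_d-decomposition of E(p), so that ã = (1+x)·E(p) − x·R_d(E(p)). Then ã is real-rooted and ã ≺ (x+1)·E_d^d. -/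
open Polynomial
open scoped Classical

namespace Stmt6Aux

/-! ### The operator `E` -/

noncomputable def dl (q : ℝ[X]) : ℝ[X] := q.comp (X + 1) - q

lemma dl_iter_eval (p : ℝ[X]) (k : ℕ) (x : ℝ) :
    (dl^[k] p).eval x = ((fwdDiff (1:ℝ))^[k] p.eval) x := by
  induction k generalizing x with
  | zero => rfl
  | succ k ih =>
    rw [Function.iterate_succ_apply', Function.iterate_succ_apply']
    simp [dl, fwdDiff, ih]

lemma coeff_subdivE (p : ℝ[X]) (k : ℕ) : (subdivE p).coeff k = (dl^[k] p).eval 0 := by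
  have h : subdivE p = ∑ k ∈ Finset.range (p.natDegree + 1),
    Polynomial.C ((dl^[k] p).eval 0) * X ^ k := rfl
  rw [h, finsetSum_coeff]
  simp only [coeff_C_mul, coeff_X_pow, mul_ite, mul_one, mul_zero, Finset.sum_ite_eq,
    Finset.mem_range]
  split_ifs with hk
  · rfl
  · rw [dl_iter_eval, Polynomial.fwdDiff_iter_eq_zero_of_degree_lt]
    · rfl
    · omega

lemma dl_add (p q : ℝ[X]) : dl (p + q) = dl p + dl q := by simp [dl]; ring
lemma dl_C_mul (c : ℝ) (q : ℝ[X]) : dl (C c * q) = C c * dl q := by simp [dl]; ring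
lemma dl_X_mul (p : ℝ[X]) : dl (X * p) = X * dl p + dl p + p := by simp [dl]; ring

lemma dl_iter_add (p q : ℝ[X]) (k : ℕ) : dl^[k] (p + q) = dl^[k] p + dl^[k] q := by
  induction k with
  | zero => rfl
  | succ k ih => simp only [Function.iterate_succ_apply', ih, dl_add]

lemma dl_iter_C_mul (c : ℝ) (q : ℝ[X]) (k : ℕ) : dl^[k] (C c * q) = C c * dl^[k] q := by
  induction k with
  | zero => rfl
  | succ k ih => simp only [Function.iterate_succ_apply', ih, dl_C_mul]

lemma dl_iter_X_mul (p : ℝ[X]) (k : ℕ) :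
    dl^[k+1] (X * p) = X * dl^[k+1] p + C ((k:ℝ)+1) * (dl^[k+1] p + dl^[k] p) := by
  induction k with
  | zero => simp [dl_X_mul]; ring
  | succ k ih =>
    rw [Function.iterate_succ_apply', ih, dl_add, dl_X_mul, dl_C_mul, dl_add]
    simp only [Function.iterate_succ_apply', map_add, Nat.cast_add, Nat.cast_one, map_one]
    ring

lemma E_add (p q : ℝ[X]) : subdivE (p + q) = subdivE p + subdivE q := by
  ext k; simp [coeff_subdivE, dl_iter_add]

lemma E_C_mul (c : ℝ) (q : ℝ[X]) : subdivE (C c * q) = C c * subdivE q := by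
  ext k; simp [coeff_subdivE, dl_iter_C_mul]

lemma E_zero : subdivE 0 = 0 := by
  simpa using E_C_mul 0 0

lemma E_sum {ι : Type*} (s : Finset ι) (f : ι → ℝ[X]) :
    subdivE (∑ i ∈ s, f i) = ∑ i ∈ s, subdivE (f i) := by
  classical
  induction s using Finset.induction_on with
  | empty => simp [E_zero]
  | insert i s hi ih => rw [Finset.sum_insert hi, Finset.sum_insert hi, E_add, ih]

lemma E_one : subdivE 1 = 1 := by
  simp [subdivE]

lemma E_C (c : ℝ) : subdivE (C c) = C c := by
  simpa [E_one] using E_C_mul c 1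

lemma E_X_mul (p : ℝ[X]) : subdivE (X * p) = X * derivative ((1 + X) * subdivE p) := by
  ext k
  rw [coeff_subdivE]
  cases k with
  | zero => simp
  | succ k =>
    rw [dl_iter_X_mul, coeff_X_mul, coeff_derivative, add_mul, one_mul, coeff_add, coeff_X_mul,
      coeff_subdivE, coeff_subdivE]
    simp; ring

lemma E_X_add_one_mul (p : ℝ[X]) :
    subdivE ((X + 1) * p) = (1 + X) * derivative (X * subdivE p) := by
  rw [add_mul, one_mul, E_add, E_X_mul]
  simp only [derivative_mul, derivative_add, derivative_one, derivative_X]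
  ring

lemma E_comp (p : ℝ[X]) : subdivE (p.comp (-1 - X)) = (subdivE p).comp (-1 - X) := by
  induction p using Polynomial.induction_on with
  | C a => simp [E_C]
  | add p q hp hq => simp [E_add, hp, hq]
  | monomial n a h =>
    have e1 : C a * X ^ (n+1) = X * (C a * X ^ n) := by ring
    rw [e1]
    generalize C a * X ^ n = p at *
    have e2 : (X * p).comp (-1 - X) = C (-1) * ((X + 1) * p.comp (-1 - X)) := by
      simp; ring
    rw [e2, E_C_mul, E_X_add_one_mul, h, E_X_mul]
    simp only [derivative_mul, derivative_add, derivative_one, derivative_X, mul_comp, add_comp,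
      X_comp, one_comp, derivative_comp, derivative_sub, derivative_neg, map_neg, map_one, zero_add]
    ring

/-! ### The polynomials `E_k^d` -/

lemma Ekd_zero : Ekd 0 0 = 1 := by simp [Ekd, E_one]

lemma Ekd_succ_succ (d k : ℕ) :
    Ekd (d+1) (k+1) = X * derivative ((1 + X) * Ekd d k) := by
  unfold Ekd
  rw [← E_X_mul]; congr 1
  rw [Nat.add_sub_add_right]; ring

lemma Ekd_succ (d k : ℕ) (h : k ≤ d) :
    Ekd (d+1) k = (1 + X) * derivative (X * Ekd d k) := by
  unfold Ekd
  rw [← E_X_add_one_mul]; congr 1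
  rw [Nat.succ_sub h, pow_succ]; ring

lemma X_mul_Ekd_zero (d : ℕ) :
    derivative (X * Ekd d 0) = derivative ((1 + X) * Ekd d d) := by
  induction d with
  | zero => simp [Ekd_zero]
  | succ d ih =>
    rw [Ekd_succ d 0 (Nat.zero_le _), Ekd_succ_succ, ih]
    congr 1; ring

lemma Ekd_succ_zero (d : ℕ) :
    Ekd (d+1) 0 = (1 + X) * derivative ((1 + X) * Ekd d d) := by
  rw [Ekd_succ d 0 (Nat.zero_le _), X_mul_Ekd_zero]

lemma Ekd_eval (d : ℕ) : (Ekd d d).eval (-1) = (-1) ^ d := by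
  induction d with
  | zero => simp [Ekd_zero]
  | succ d ih => rw [Ekd_succ_succ]; simp [ih, pow_succ]

lemma Ekd_ne (d : ℕ) : Ekd d d ≠ 0 := by
  intro h
  have := Ekd_eval d
  rw [h, eval_zero] at this
  exact pow_ne_zero d (by norm_num) this.symm

lemma Rflip_Ekd (d k : ℕ) (h : k ≤ d) : Rflip d (Ekd d k) = Ekd d (d - k) := by
  unfold Rflip Ekd
  rw [← E_comp, smul_eq_C_mul, ← E_C_mul]
  congr 1
  have e : d - (d - k) = k := by omega
  rw [e]
  obtain ⟨j, rfl⟩ := Nat.exists_eq_add_of_le h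
  simp only [mul_comp, pow_comp, X_comp, add_comp, one_comp, map_pow, map_neg, map_one,
    Nat.add_sub_cancel_left]
  have e1 : (-1 - X : ℝ[X]) = -1 * (X + 1) := by ring
  have e2 : (-1 * (X + 1) + 1 : ℝ[X]) = -1 * X := by ring
  rw [e1, e2, mul_pow, mul_pow, pow_add]
  have a1 : ((-1 : ℝ[X]) ^ k) * (-1) ^ k = 1 := by rw [← mul_pow]; simp
  have a2 : ((-1 : ℝ[X]) ^ j) * (-1) ^ j = 1 := by rw [← mul_pow]; simp
  linear_combination (X ^ j * (X + 1) ^ k) * a1 * ((-1 : ℝ[X]) ^ j * (-1) ^ j) +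
    (X ^ j * (X + 1) ^ k) * a2

/-! ### Stability -/

lemma StableC.mul {f g : ℂ[X]} (hf : StableC f) (hg : StableC g) : StableC (f * g) := by
  rcases hf with rfl | hf
  · left; simp
  rcases hg with rfl | hg
  · left; simp
  right
  intro z hz
  rw [eval_mul]
  exact mul_ne_zero (hf z hz) (hg z hz)

lemma StableC.deriv {f : ℂ[X]} (hf : StableC f) : StableC (derivative f) := by
  rcases hf with rfl | hf
  · left; simp
  by_cases h0 : derivative f = 0
  · exact Or.inl h0
  right
  intro z hz hr
  have hd : 0 < f.degree := by
    by_contra hle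
    rw [eq_C_of_degree_le_zero (not_lt.mp hle)] at h0
    simp at h0
  have hmem : z ∈ (derivative f).rootSet ℂ := by
    rw [mem_rootSet]; exact ⟨h0, by simpa using hr⟩
  have hsub := Polynomial.rootSet_derivative_subset_convexHull_rootSet hd hmem
  have : convexHull ℝ (f.rootSet ℂ) ⊆ {w : ℂ | w.im ≤ 0} := by
    apply convexHull_min
    · intro w hw
      by_contra hlt
      simp only [Set.mem_ofPred_eq, not_le] at hlt
      rw [mem_rootSet] at hw
      exact hf w hlt (by simpa using hw.2)
    · exact convex_halfSpace_im_le 0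
  have := this hsub
  simp only [Set.mem_ofPred_eq] at this
  linarith

lemma stable_X : StableC X := by
  right; intro z hz h
  simp at h; simp [h] at hz

lemma stable_one_add_X : StableC (1 + X) := by
  right; intro z hz h
  have := congrArg Complex.im h
  simp at this; linarith

lemma toC_mul (p q : ℝ[X]) : toC (p * q) = toC p * toC q := by simp [toC]
lemma toC_add (p q : ℝ[X]) : toC (p + q) = toC p + toC q := by simp [toC]
lemma toC_neg (p : ℝ[X]) : toC (-p) = - toC p := by simp [toC]
lemma toC_X : toC X = X := by simp [toC]
lemma toC_one : toC 1 = 1 := by simp [toC]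
lemma toC_deriv (p : ℝ[X]) : toC (derivative p) = derivative (toC p) := by
  simp [toC, derivative_map]

lemma Int.mul {p q : ℝ[X]} (r : ℝ[X]) (hr : StableC (toC r)) (h : Interlaces p q) :
    Interlaces (r * p) (r * q) := by
  unfold Interlaces at *
  have : toC (r * q) + C Complex.I * toC (r * p) = toC r * (toC q + C Complex.I * toC p) := by
    rw [toC_mul, toC_mul]; ring
  rw [this]; exact StableC.mul hr h

lemma Int.deriv {p q : ℝ[X]} (h : Interlaces p q) :
    Interlaces (derivative p) (derivative q) := by
  unfold Interlaces at *
  have : toC (derivative q) + C Complex.I * toC (derivative p)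
      = derivative (toC q + C Complex.I * toC p) := by
    simp [toC_deriv]
  rw [this]; exact StableC.deriv h

lemma st_X : StableC (toC X) := by rw [toC_X]; exact stable_X
lemma st_oX : StableC (toC (1 + X)) := by rw [toC_add, toC_one, toC_X]; exact stable_one_add_X

lemma stable_Ekd (d : ℕ) : StableC (toC (Ekd d d)) := by
  induction d with
  | zero => rw [Ekd_zero, toC_one]; right; intro z hz; simp
  | succ d ih =>
    rw [Ekd_succ_succ, toC_mul, toC_deriv, toC_mul]
    exact StableC.mul st_X (StableC.deriv (StableC.mul st_oX ih))

lemma int_self (q : ℝ[X]) (h : StableC (toC q)) : Interlaces q q := by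
  have : Interlaces 1 1 := by
    right; intro z hz h0
    have := congrArg Complex.re h0
    simp [toC] at this
  simpa using Int.mul q h this

lemma int_a : Interlaces (1 + X) X := by
  right; intro z hz h0
  have h1 := congrArg Complex.re h0
  have h2 := congrArg Complex.im h0
  simp [toC] at h1 h2
  linarith

lemma int_b : Interlaces (-X) (1 + X) := by
  right; intro z hz h0
  have h1 := congrArg Complex.re h0
  have h2 := congrArg Complex.im h0
  simp [toC] at h1 h2
  linarith

lemma T (d : ℕ) : ∀ k ≤ d, Interlaces (Ekd d k) (Ekd d d) := by
  induction d with
  | zero =>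
    intro k hk
    obtain rfl : k = 0 := by omega
    exact int_self _ (stable_Ekd 0)
  | succ d ih =>
    intro k hk
    cases k with
    | zero =>
      rw [Ekd_succ_zero, Ekd_succ_succ, mul_comm (1 + X), mul_comm X]
      refine Int.mul _ ?_ int_a
      rw [toC_deriv, toC_mul]
      exact StableC.deriv (StableC.mul st_oX (stable_Ekd d))
    | succ k =>
      rw [Ekd_succ_succ, Ekd_succ_succ]
      exact Int.mul _ st_X (Int.deriv (Int.mul _ st_oX (ih k (by omega))))

lemma S (d : ℕ) : ∀ k ≤ d, Interlaces (-(X * Ekd d k)) ((1 + X) * Ekd d d) := by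
  induction d with
  | zero =>
    intro k hk
    obtain rfl : k = 0 := by omega
    simpa [Ekd_zero] using int_b
  | succ d ih =>
    intro k hk
    rcases Nat.lt_or_ge d k with h | h
    · obtain rfl : k = d + 1 := by omega
      have := Int.mul _ (stable_Ekd (d+1)) int_b
      convert this using 1 <;> ring
    · rw [Ekd_succ d k h, Ekd_succ_succ]
      have h2 := Int.mul _ st_oX (Int.mul _ st_X (Int.deriv (ih k h)))
      convert h2 using 1
      rw [derivative_neg]; ring

/-! ### The cone of polynomials interlacing a fixed one -/

lemma toC_eval_conj (p : ℝ[X]) (z : ℂ) :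
    (toC p).eval ((starRingEnd ℂ) z) = (starRingEnd ℂ) ((toC p).eval z) := by
  have h := Polynomial.hom_eval₂ p (algebraMap ℝ ℂ) (starRingEnd ℂ) z
  have e : (starRingEnd ℂ).comp (algebraMap ℝ ℂ) = algebraMap ℝ ℂ := by
    ext x; simp
  rw [e] at h
  simp only [toC, eval_map]
  exact h.symm

lemma norm_conj_le {f : ℂ[X]} (hf : StableC f) (z : ℂ) (hz : 0 < z.im) :
    ‖f.eval ((starRingEnd ℂ) z)‖ ≤ ‖f.eval z‖ := by
  rcases hf with rfl | hf
  · simp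
  have hr : ∀ a ∈ f.roots, a.im ≤ 0 := by
    intro a ha
    by_contra h
    exact hf a (not_le.mp h) (isRoot_of_mem_roots ha)
  have hs := (IsAlgClosed.splits f).eval_eq_prod_roots
  rw [hs, hs, norm_mul, norm_mul]
  refine mul_le_mul_of_nonneg_left ?_ (norm_nonneg _)
  clear hs hf
  generalize f.roots = s at hr
  induction s using Multiset.induction_on with
  | empty => simp
  | cons a s ih =>
    simp only [Multiset.map_cons, Multiset.prod_cons, norm_mul]
    refine mul_le_mul ?_ (ih fun b hb => hr b (Multiset.mem_cons_of_mem hb)) (norm_nonneg _)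
      (norm_nonneg _)
    have ha := hr a (Multiset.mem_cons_self a s)
    rw [Complex.norm_def, Complex.norm_def]
    apply Real.sqrt_le_sqrt
    simp only [Complex.normSq_apply, Complex.sub_re, Complex.sub_im, Complex.conj_re,
      Complex.conj_im]
    nlinarith

def W (p q : ℝ[X]) : Prop :=
  ∀ z : ℂ, 0 < z.im → 0 ≤ ((toC q).eval z * (starRingEnd ℂ) ((toC p).eval z)).im

lemma W_of_int {p q : ℝ[X]} (h : Interlaces p q) : W p q := by
  intro z hz
  have := norm_conj_le h z hz
  simp only [eval_add, eval_mul, eval_C, toC_eval_conj] at this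
  generalize (toC q).eval z = u at *
  generalize (toC p).eval z = v at *
  have h2 := mul_self_le_mul_self (norm_nonneg _) this
  rw [Complex.norm_mul_self_eq_normSq, Complex.norm_mul_self_eq_normSq] at h2
  simp [Complex.normSq_apply] at h2 ⊢
  nlinarith

lemma int_of_W {p q : ℝ[X]} (h : W p q) (hq : ∀ z : ℂ, 0 < z.im → (toC q).eval z ≠ 0) :
    Interlaces p q := by
  right
  intro z hz h0
  have h1 := h z hz
  have h2 := hq z hz
  simp only [eval_add, eval_mul, eval_C] at h0
  generalize (toC q).eval z = u at *
  generalize (toC p).eval z = v at *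
  have hu : u = -(Complex.I * v) := by linear_combination h0
  apply h2
  rw [hu] at h1 ⊢
  simp at h1
  have hr : v.re = 0 := by nlinarith [sq_nonneg v.re, sq_nonneg v.im]
  have hi : v.im = 0 := by nlinarith [sq_nonneg v.re, sq_nonneg v.im]
  have : v = 0 := Complex.ext hr hi
  simp [this]

lemma W_add {p p' q : ℝ[X]} (h : W p q) (h' : W p' q) : W (p + p') q := by
  intro z hz
  have := h z hz
  have := h' z hz
  rw [toC_add, eval_add, map_add, mul_add, Complex.add_im]
  linarith

lemma W_smul {p q : ℝ[X]} (c : ℝ) (hc : 0 ≤ c) (h : W p q) : W (C c * p) q := by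
  intro z hz
  have h1 := mul_nonneg hc (h z hz)
  have : (toC (C c * p)).eval z = (c : ℂ) * (toC p).eval z := by simp [toC]
  rw [this, map_mul, Complex.conj_ofReal, mul_left_comm, Complex.im_ofReal_mul]
  exact h1

lemma W_sum {q : ℝ[X]} (s : Finset ℕ) (f : ℕ → ℝ[X]) (h : ∀ i ∈ s, W (f i) q) :
    W (∑ i ∈ s, f i) q := by
  classical
  induction s using Finset.induction_on with
  | empty => intro z hz; simp [toC]
  | insert i s hi ih =>
    rw [Finset.sum_insert hi]
    exact W_add (h i (Finset.mem_insert_self _ _))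
      (ih fun j hj => h j (Finset.mem_insert_of_mem hj))

lemma realRooted_of_W {p q : ℝ[X]} (h : W p q)
    (hq : ∀ z : ℂ, 0 < z.im → (toC q).eval z ≠ 0) : RealRooted p := by
  by_cases hp : p = 0
  · exact Or.inl hp
  right
  have key : ∀ z : ℂ, 0 < z.im → (toC p).eval z ≠ 0 := by
    intro z hz h0
    set U : Set ℂ := {w | 0 < w.im} with hU
    have hUo : IsOpen U := isOpen_lt continuous_const Complex.continuous_im
    have hUc : IsPreconnected U := (convex_halfSpace_im_gt 0).isPreconnected
    set g : ℂ → ℂ := fun w => (toC p).eval w / (toC q).eval w with hg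
    have han : AnalyticOnNhd ℂ g U := by
      apply DifferentiableOn.analyticOnNhd _ hUo
      exact DifferentiableOn.div (toC p).differentiable.differentiableOn
        (toC q).differentiable.differentiableOn hq
    have him : ∀ w ∈ U, (g w).im ≤ 0 := by
      intro w hw
      have h1 := h w hw
      simp only [hg]
      generalize (toC q).eval w = u at *
      generalize (toC p).eval w = v at *
      rw [Complex.div_im, ← sub_div]
      apply div_nonpos_of_nonpos_of_nonneg _ (Complex.normSq_nonneg _)
      simp at h1
      linarith
    have hgz : g z = 0 := by simp [hg, h0]
    rcases han.is_constant_or_isOpen hUc with ⟨w, hw⟩ | ho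
    · have hw0 : w = 0 := by rw [← hw z hz, hgz]
      apply hp
      have hinf : Set.Infinite U := by
        apply infinite_of_mem_nhds z (hUo.mem_nhds hz)
      have : toC p = 0 := by
        apply Polynomial.eq_zero_of_infinite_isRoot
        refine hinf.mono ?_
        intro w' hw'
        have := hw w' hw'
        rw [hw0] at this
        simp only [hg, div_eq_zero_iff] at this
        exact this.resolve_right (hq w' hw')
      exact (Polynomial.map_eq_zero_iff (algebraMap ℝ ℂ).injective).mp this
    · have hop := ho U subset_rfl hUo
      have hmem : (0:ℂ) ∈ Set.image g U := ⟨z, hz, hgz⟩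
      obtain ⟨ε, hε, hball⟩ := Metric.isOpen_iff.mp hop 0 hmem
      have : (((ε/2 : ℝ) : ℂ) * Complex.I) ∈ Metric.ball (0:ℂ) ε := by
        rw [mem_ball_zero_iff, norm_mul, Complex.norm_I, mul_one, Complex.norm_real,
          Real.norm_eq_abs, abs_of_pos (by linarith)]
        linarith
      obtain ⟨w, hw, hgw⟩ := hball this
      have h3 := him w hw
      rw [hgw, Complex.im_ofReal_mul, Complex.I_im] at h3
      linarith
  intro z h0
  rcases lt_trichotomy z.im 0 with hz | hz | hz
  · exact absurd (by rw [toC_eval_conj, h0, map_zero]) (key ((starRingEnd ℂ) z) (by simpa using hz))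
  · exact hz
  · exact absurd h0 (key z hz)

end Stmt6Aux

/-- for `p = Σ_k a_k x^k (x+1)^{d-k}` with `a_k ≥ 0`, the polynomial
`ã = (1+x)·E(p) - x·R_d(E(p))` from the `R_d`-decomposition of `E(p)` is real-rooted
and satisfies `ã ≺ (x+1)·E_d^d`. -/
theorem stmt6 (d : ℕ) (a : ℕ → ℝ) (ha : ∀ k, 0 ≤ a k)
    (p : ℝ[X])
    (hp : p = ∑ k ∈ Finset.range (d + 1), Polynomial.C (a k) * X ^ k * (X + 1) ^ (d - k)) :
    RealRooted ((1 + X) * subdivE p - X * Rflip d (subdivE p)) ∧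
    Interlaces ((1 + X) * subdivE p - X * Rflip d (subdivE p)) ((X + 1) * Ekd d d) := by
  have hE : subdivE p = ∑ k ∈ Finset.range (d + 1), Polynomial.C (a k) * Ekd d k := by
    rw [hp, Stmt6Aux.E_sum]
    refine Finset.sum_congr rfl fun k _ => ?_
    rw [mul_assoc, Stmt6Aux.E_C_mul, Ekd]
  have hR : Rflip d (subdivE p)
      = ∑ k ∈ Finset.range (d + 1), Polynomial.C (a k) * Ekd d (d - k) := by
    rw [hE]
    unfold Rflip
    rw [← Polynomial.coe_compRingHom_apply, map_sum, Finset.smul_sum]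
    simp only [Polynomial.coe_compRingHom_apply]
    refine Finset.sum_congr rfl fun k hk => ?_
    rw [← Stmt6Aux.Rflip_Ekd d k (by simpa [Nat.lt_succ_iff] using hk), Rflip]
    simp
  have hA : (1 + X) * subdivE p - X * Rflip d (subdivE p) = ∑ k ∈ Finset.range (d + 1),
      Polynomial.C (a k) * ((1 + X) * Ekd d k + -(X * Ekd d (d - k))) := by
    rw [hR, hE, Finset.mul_sum, Finset.mul_sum, ← Finset.sum_sub_distrib]
    refine Finset.sum_congr rfl fun k _ => ?_
    ring
  have hq : ∀ z : ℂ, 0 < z.im → (toC ((X + 1) * Ekd d d)).eval z ≠ 0 := by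
    rw [add_comm X 1, Stmt6Aux.toC_mul]
    have h1 := Stmt6Aux.StableC.mul Stmt6Aux.st_oX (Stmt6Aux.stable_Ekd d)
    refine h1.resolve_left ?_
    rw [← Stmt6Aux.toC_mul]
    intro h
    have h2 := (Polynomial.map_eq_zero_iff (algebraMap ℝ ℂ).injective).mp h
    rcases mul_eq_zero.mp h2 with h3 | h3
    · have := congrArg (Polynomial.eval 0) h3
      simp at this
    · exact Stmt6Aux.Ekd_ne d h3
  have hW : Stmt6Aux.W ((1 + X) * subdivE p - X * Rflip d (subdivE p)) ((X + 1) * Ekd d d) := by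
    rw [hA, add_comm X 1]
    refine Stmt6Aux.W_sum _ _ fun k hk => Stmt6Aux.W_smul _ (ha k) (Stmt6Aux.W_add ?_ ?_)
    · exact Stmt6Aux.W_of_int (Stmt6Aux.Int.mul _ Stmt6Aux.st_oX
        (Stmt6Aux.T d k (by simpa [Nat.lt_succ_iff] using hk)))
    · exact Stmt6Aux.W_of_int (Stmt6Aux.S d (d - k) (Nat.sub_le _ _))
  exact ⟨Stmt6Aux.realRooted_of_W hW hq, Stmt6Aux.int_of_W hW hq⟩
end
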